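/- In the main setup below, let γ_i := v_i(ℝ) ∪ {x_i, y_i} denote the closed trajectory of the heteroclinic v_i (i = 1,…,k−1) and let G := graph(u) ∪ ⋃_{i=1}^{k−1} ({t_i} × γ_i) ⊂ [0,T] × ℝⁿ. Then sup_{t∈[0,T]} dist((t, u_ε(t)), G) → 0 as ε → 0, where dist denotes the Euclidean distance in ℝ^{1+n} from a point to the set G. -/

import Mathlib

open Set Filter Topology
open scoped RealInnerProductSpace

/-- The set of pairs `(t, ξ)` with `t ∈ [0,T]` such that `ξ` is a degenerate critical
point of `f t`. -/
noncomputable def degenerateCriticalSet {n : ℕ} (T : ℝ)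
    (f : ℝ → EuclideanSpace ℝ (Fin n) → ℝ) :
    Set (ℝ × EuclideanSpace ℝ (Fin n)) :=
  {p | p.1 ∈ Set.Icc 0 T ∧ gradient (f p.1) p.2 = 0 ∧
    LinearMap.det ((fderiv ℝ (gradient (f p.1)) p.2 :
      EuclideanSpace ℝ (Fin n) →L[ℝ] EuclideanSpace ℝ (Fin n)) :
      EuclideanSpace ℝ (Fin n) →ₗ[ℝ] EuclideanSpace ℝ (Fin n)) = 0}

/-- The Hessian of `f t` at `x` is positive definite. -/
noncomputable def HessPosDef {n : ℕ} (f : ℝ → EuclideanSpace ℝ (Fin n) → ℝ)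
    (t : ℝ) (x : EuclideanSpace ℝ (Fin n)) : Prop :=
  ∀ y : EuclideanSpace ℝ (Fin n), y ≠ 0 → 0 < ⟪(fderiv ℝ (gradient (f t)) x) y, y⟫

/-- The Hessian of `f t` at `x` is positive semidefinite. -/
noncomputable def HessPosSemidef {n : ℕ} (f : ℝ → EuclideanSpace ℝ (Fin n) → ℝ)
    (t : ℝ) (x : EuclideanSpace ℝ (Fin n)) : Prop :=
  ∀ y : EuclideanSpace ℝ (Fin n), 0 ≤ ⟪(fderiv ℝ (gradient (f t)) x) y, y⟫

/-- The gradient with respect to `x` of the partial derivative `f_t`. -/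
noncomputable def gradft {n : ℕ} (f : ℝ → EuclideanSpace ℝ (Fin n) → ℝ)
    (t : ℝ) (x : EuclideanSpace ℝ (Fin n)) : EuclideanSpace ℝ (Fin n) :=
  gradient (fun z => deriv (fun s => f s z) t) x

/-- The third spatial derivative of `f t` at `x` evaluated three times at `ℓ`. -/
noncomputable def thirdDeriv {n : ℕ} (f : ℝ → EuclideanSpace ℝ (Fin n) → ℝ)
    (t : ℝ) (x ℓ : EuclideanSpace ℝ (Fin n)) : ℝ :=
  iteratedFDeriv ℝ 3 (f t) x ![ℓ, ℓ, ℓ]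


section Calculus

theorem eventually_le_of_hasDerivWithinAt_neg {p : ℝ → ℝ} {p' s c : ℝ}
    (hp : HasDerivWithinAt p p' (Ici s) s) (hs : p s ≤ c) (hc : p s = c → p' < 0) :
    ∀ᶠ r in 𝓝[>] s, p r ≤ c := by
  rcases hs.lt_or_eq with h | h
  · have h1 : Tendsto p (𝓝[>] s) (𝓝 (p s)) :=
      (hp.continuousWithinAt.mono Ioi_subset_Ici_self)
    filter_upwards [h1.eventually_lt_const h] with r hr using hr.le
  · have h1 := (hp.mono Ioi_subset_Ici_self).limsup_slope_le' (by simp) (hc h)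
    filter_upwards [h1, self_mem_nhdsWithin] with r hr hrs
    rw [slope_def_field, div_neg_iff] at hr
    have : 0 < r - s := sub_pos.2 hrs
    rcases hr with hr | hr <;> linarith [hr.1, hr.2]

/-- Two simultaneous barriers: a region `p ≤ P`, `q ≤ Q` whose faces point inwards is
forward invariant. -/
theorem le_and_le_of_deriv_neg_at_boundary {p q p' q' : ℝ → ℝ} {a b P Q : ℝ}
    (hp : ContinuousOn p (Icc a b)) (hq : ContinuousOn q (Icc a b))
    (hp' : ∀ s ∈ Ico a b, HasDerivWithinAt p (p' s) (Ici s) s)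
    (hq' : ∀ s ∈ Ico a b, HasDerivWithinAt q (q' s) (Ici s) s)
    (hpa : p a ≤ P) (hqa : q a ≤ Q)
    (hbp : ∀ s ∈ Ico a b, p s = P → q s ≤ Q → p' s < 0)
    (hbq : ∀ s ∈ Ico a b, q s = Q → p s ≤ P → q' s < 0) :
    ∀ s ∈ Icc a b, p s ≤ P ∧ q s ≤ Q := by
  have key : Icc a b ⊆ {s | p s ≤ P ∧ q s ≤ Q} := by
    apply IsClosed.Icc_subset_of_forall_exists_gt
    · have h1 : IsClosed (Icc a b ∩ p ⁻¹' Iic P) := hp.preimage_isClosed_of_isClosed isClosed_Icc isClosed_Iic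
      have h2 : IsClosed (Icc a b ∩ q ⁻¹' Iic Q) := hq.preimage_isClosed_of_isClosed isClosed_Icc isClosed_Iic
      convert h1.inter h2 using 1
      ext s
      simp only [mem_inter_iff, mem_ofPred_eq, mem_preimage, mem_Iic]
      tauto
    · exact ⟨hpa, hqa⟩
    · rintro s ⟨⟨h1, h2⟩, hs⟩ y hy
      have e1 := eventually_le_of_hasDerivWithinAt_neg (hp' s hs) h1 (fun h => hbp s hs h h2)
      have e2 := eventually_le_of_hasDerivWithinAt_neg (hq' s hs) h2 (fun h => hbq s hs h h1)
      have e3 : ∀ᶠ r in 𝓝[>] s, r ∈ Ioc s y := Ioc_mem_nhdsGT hy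
      obtain ⟨r, hr1, hr2, hr3⟩ := (e1.and (e2.and e3)).exists
      exact ⟨r, ⟨hr1, hr2⟩, hr3⟩
  exact key

theorem forall_lt_or_exists_first_hit {q : ℝ → ℝ} {a b c : ℝ}
    (hq : ContinuousOn q (Icc a b)) (hqa : q a < c) :
    (∀ s ∈ Icc a b, q s < c) ∨ ∃ s₁ ∈ Ioc a b, q s₁ = c ∧ ∀ s ∈ Ico a s₁, q s < c := by
  by_cases h : ∀ s ∈ Icc a b, q s < c
  · exact Or.inl h
  · right
    push Not at h
    obtain ⟨s₀, hs₀, hs₀c⟩ := h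
    have hcl : IsCompact (Icc a b ∩ q ⁻¹' Ici c) :=
      isCompact_Icc.of_isClosed_subset
        (hq.preimage_isClosed_of_isClosed isClosed_Icc isClosed_Ici) inter_subset_left
    obtain ⟨s₁, ⟨hs₁, hs₁c⟩, hmin⟩ := hcl.exists_isLeast ⟨s₀, hs₀, hs₀c⟩
    have hlt : ∀ s ∈ Ico a s₁, q s < c := by
      intro s hs
      by_contra hcon
      have := hmin ⟨⟨hs.1, hs.2.le.trans hs₁.2⟩, not_lt.1 hcon⟩
      exact absurd hs.2 (not_lt.2 this)
    have hne : a ≠ s₁ := by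
      rintro rfl
      exact absurd hqa (not_lt.2 hs₁c)
    have has : a < s₁ := lt_of_le_of_ne hs₁.1 hne
    refine ⟨s₁, ⟨has, hs₁.2⟩, le_antisymm ?_ hs₁c, hlt⟩
    have h1 : Tendsto q (𝓝[Ico a s₁] s₁) (𝓝 (q s₁)) :=
      (hq s₁ hs₁).mono (fun s hs => ⟨hs.1, hs.2.le.trans hs₁.2⟩)
    have : (𝓝[Ico a s₁] s₁).NeBot := by
      rw [← mem_closure_iff_nhdsWithin_neBot, closure_Ico has.ne]
      exact ⟨hs₁.1, le_rfl⟩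
    exact le_of_tendsto h1 (by filter_upwards [self_mem_nhdsWithin] with s hs using (hlt s hs).le)

/-- Second-order Taylor expansion at a point. -/
theorem ContDiffAt.eventually_taylor_two {V : Type*} [NormedAddCommGroup V] [NormedSpace ℝ V]
    {h : V → ℝ} {p : V} (hh : ContDiffAt ℝ 2 h p) {ϑ : ℝ} (hϑ : 0 < ϑ) :
    ∀ᶠ v in 𝓝 (0 : V),
      |h (p + v) - h p - fderiv ℝ h p v - 1 / 2 * fderiv ℝ (fderiv ℝ h) p v v| ≤ ϑ * ‖v‖ ^ 2 := by
  have hd : ∀ᶠ x in 𝓝 p, DifferentiableAt ℝ h x := by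
    filter_upwards [hh.eventually (by simp)] with x hx using hx.differentiableAt (by simp)
  have hdd : HasFDerivAt (fderiv ℝ h) (fderiv ℝ (fderiv ℝ h) p) p :=
    ((hh.fderiv_right (m := 1) (by norm_num)).differentiableAt (by simp)).hasFDerivAt
  have hsymm : IsSymmSndFDerivAt ℝ h p := hh.isSymmSndFDerivAt (by simp)
  have h1 := (hasFDerivAt_iff_isLittleO_nhds_zero.1 hdd).def hϑ
  have hshift : Tendsto (fun v : V => p + v) (𝓝 0) (𝓝 p) := by
    have : ContinuousAt (fun v : V => p + v) 0 := by fun_prop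
    simpa [ContinuousAt] using this
  obtain ⟨δ, hδ, hball⟩ := Metric.eventually_nhds_iff_ball.1 (h1.and (hshift.eventually hd))
  filter_upwards [Metric.ball_mem_nhds (0 : V) hδ] with v hv
  set B := fderiv ℝ (fderiv ℝ h) p with hB
  let r : V → ℝ := fun v => h (p + v) - h p - fderiv ℝ h p v - 1 / 2 * B v v
  have hr : ∀ w ∈ Metric.closedBall (0 : V) ‖v‖,
      HasFDerivWithinAt r (fderiv ℝ h (p + w) - fderiv ℝ h p - B w)
        (Metric.closedBall (0 : V) ‖v‖) w := by
    intro w hw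
    have hw' : w ∈ Metric.ball (0 : V) δ := by
      simp only [mem_closedBall_zero_iff, mem_ball_zero_iff] at *
      linarith
    have e1 : HasFDerivAt (fun v => h (p + v)) (fderiv ℝ h (p + w)) w := by
      have := (hball w hw').2.hasFDerivAt
      exact (hasFDerivAt_comp_add_left p).2 this
    have e2 : HasFDerivAt (fun v => B v v) (B w + B.flip w) w := by
      have := B.hasFDerivAt_of_bilinear (hasFDerivAt_id w) (hasFDerivAt_id w)
      refine this.congr_fderiv ?_
      ext z; simp
    have e3 := ((e1.sub_const (h p)).sub (fderiv ℝ h p).hasFDerivAt).sub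
      (e2.const_mul (1 / 2 : ℝ))
    refine (e3.congr_fderiv ?_).hasFDerivWithinAt
    ext z
    have := hsymm.eq z w
    simp only [sub_apply, smul_apply,
      add_apply, ContinuousLinearMap.flip_apply, smul_eq_mul]
    rw [hB, this]
    ring
  have hb : ∀ w ∈ Metric.closedBall (0 : V) ‖v‖,
      ‖fderiv ℝ h (p + w) - fderiv ℝ h p - B w‖ ≤ ϑ * ‖v‖ := by
    intro w hw
    have hw' : w ∈ Metric.ball (0 : V) δ := by
      simp only [mem_closedBall_zero_iff, mem_ball_zero_iff] at *
      linarith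
    refine (hball w hw').1.trans ?_
    have : ‖w‖ ≤ ‖v‖ := by simpa using hw
    gcongr
  have := (convex_closedBall (0 : V) ‖v‖).norm_image_sub_le_of_norm_hasFDerivWithin_le hr hb
    (Metric.mem_closedBall_self (norm_nonneg v)) (by simp : v ∈ Metric.closedBall (0 : V) ‖v‖)
  simp only [r, sub_zero, add_zero, map_zero, mul_zero, sub_self, Real.norm_eq_abs] at this
  calc _ ≤ ϑ * ‖v‖ * ‖v‖ := this
    _ = _ := by ring

end Calculus

section Comparison

variable {E : Type*} [NormedAddCommGroup E] [InnerProductSpace ℝ E]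

/-- A forward Grönwall-type comparison where the differential inequality is only known as long
as the function stays below `r`. -/
theorem norm_le_mul_exp_of_deriv_le {d d' : ℝ → E} {S L θ μ r : ℝ}
    (hd : ∀ s ∈ Icc 0 S, HasDerivAt d (d' s) s) (hL : 0 ≤ L) (hμ : 0 < μ) (hθ : θ ≤ μ)
    (hd' : ∀ s ∈ Icc 0 S, ‖d s‖ ≤ r → ‖d' s‖ ≤ L * ‖d s‖ + θ)
    (h0 : ‖d 0‖ ≤ μ) (hr : μ * Real.exp ((L + 2) * S) ≤ r) :
    ∀ s ∈ Icc 0 S, ‖d s‖ ≤ μ * Real.exp ((L + 2) * s) := by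
  have hq : ∀ s ∈ Icc 0 S, HasDerivAt (fun s => ‖d s‖ ^ 2) (2 * ⟪d s, d' s⟫) s :=
    fun s hs => (hd s hs).norm_sq
  have hB : ∀ s : ℝ, HasDerivAt (fun s => (μ * Real.exp ((L + 2) * s)) ^ 2)
      (2 * (L + 2) * (μ * Real.exp ((L + 2) * s)) ^ 2) s := by
    intro s
    have h1 : HasDerivAt (fun s : ℝ => (L + 2) * s) (L + 2) s := by
      simpa using (hasDerivAt_id s).const_mul (L + 2)
    refine ((h1.exp.const_mul μ).pow 2).congr_deriv ?_
    simp only [Nat.cast_ofNat]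
    ring
  have key := image_le_of_deriv_right_lt_deriv_boundary' (a := 0) (b := S)
    (fun s hs => (hq s hs).continuousAt.continuousWithinAt)
    (fun s hs => (hq s (Ico_subset_Icc_self hs)).hasDerivWithinAt)
    (B := fun s => (μ * Real.exp ((L + 2) * s)) ^ 2)
    (by simpa using pow_le_pow_left₀ (norm_nonneg _) h0 2)
    (fun s _ => (hB s).continuousAt.continuousWithinAt)
    (fun s _ => (hB s).hasDerivWithinAt) ?_
  · intro s hs
    exact le_of_sq_le_sq (key hs) (by positivity)
  · intro s hs heq
    have hs0 : 0 ≤ (L + 2) * s := mul_nonneg (by linarith) hs.1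
    have h1 : ‖d s‖ = μ * Real.exp ((L + 2) * s) :=
      (pow_left_inj₀ (norm_nonneg _) (by positivity) two_ne_zero).1 heq
    have h2 : μ ≤ ‖d s‖ := by
      rw [h1]; exact le_mul_of_one_le_right hμ.le (Real.one_le_exp hs0)
    have h3 : ‖d s‖ ≤ r := by
      refine h1.le.trans (le_trans ?_ hr)
      have : s ≤ S := hs.2.le
      gcongr
    have h4 := hd' s (Ico_subset_Icc_self hs) h3
    have h5 : ⟪d s, d' s⟫ ≤ ‖d s‖ * ‖d' s‖ := real_inner_le_norm _ _
    rw [← h1]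
    nlinarith [norm_nonneg (d s), norm_nonneg (d' s)]

/-- Let `d` solve `d' = -A d + small`, where `A` is coercive on the complement of the line
spanned by `ℓ`. If `d` stays bounded on a long past interval and `d 0` is orthogonal to `ℓ`, then
`d 0` is small. -/
theorem norm_lt_of_bounded_past {d d' : ℝ → E} {ℓ : E} {A : E →L[ℝ] E} {S lam κ θ μ M : ℝ}
    (hℓ : ‖ℓ‖ = 1) (hlam : 0 < lam) (hμ : 0 < μ) (hS : 0 ≤ S)
    (hA : ∀ v, lam * (‖v‖ ^ 2 - ⟪ℓ, v⟫ ^ 2) ≤ ⟪v, A v⟫) (hAℓ : ∀ v, ⟪ℓ, A v⟫ = 0)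
    (hd : ∀ s ∈ Icc (-S) 0, HasDerivAt d (d' s) s)
    (hd' : ∀ s ∈ Icc (-S) 0, ‖d' s + A (d s)‖ ≤ κ * ‖d s‖ + θ)
    (hκ : κ ≤ lam / 24) (hθ : 36 * θ ≤ lam * μ) (h0 : ⟪ℓ, d 0⟫ = 0)
    (hM : ∀ s ∈ Icc (-S) 0, ‖d s‖ ≤ M) (hMS : M ^ 2 < lam * μ ^ 2 * S / 2) :
    ‖d 0‖ < μ := by
  by_contra hcon
  push Not at hcon
  let V : ℝ → ℝ := fun s => ‖d s‖ ^ 2 - 2 * ⟪ℓ, d s⟫ ^ 2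
  let V' : ℝ → ℝ := fun s => 2 * ⟪d s, d' s⟫ - 4 * ⟪ℓ, d s⟫ * ⟪ℓ, d' s⟫
  have hV : ∀ s ∈ Icc (-S) 0, HasDerivAt V (V' s) s := by
    intro s hs
    have h1 := (hd s hs).norm_sq
    have h2 : HasDerivAt (fun s => ⟪ℓ, d s⟫) ⟪ℓ, d' s⟫ s := by
      simpa using (hasDerivAt_const s ℓ).inner ℝ (hd s hs)
    refine (h1.sub ((h2.pow 2).const_mul 2)).congr_deriv ?_
    simp only [V', Nat.cast_ofNat]
    ring
  have hV' : ∀ s ∈ Icc (-S) 0, μ ^ 2 ≤ V s → V' s ≤ -(lam * μ ^ 2) := by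
    intro s hs hVs
    simp only [V] at hVs
    simp only [V']
    set e := d' s + A (d s) with he
    have hde : d' s = e - A (d s) := by rw [he]; abel
    have h1 : ⟪d s, d' s⟫ = ⟪d s, e⟫ - ⟪d s, A (d s)⟫ := by rw [hde, inner_sub_right]
    have h2 : ⟪ℓ, d' s⟫ = ⟪ℓ, e⟫ := by rw [hde, inner_sub_right, hAℓ, sub_zero]
    have h3 := hA (d s)
    have h4 : ⟪d s, e⟫ ≤ ‖d s‖ * ‖e‖ := real_inner_le_norm _ _
    have h5 : |⟪ℓ, e⟫| ≤ ‖e‖ := by simpa [hℓ] using abs_real_inner_le_norm ℓ e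
    have h6 : |⟪ℓ, d s⟫| ≤ ‖d s‖ := by simpa [hℓ] using abs_real_inner_le_norm ℓ (d s)
    have h7 : -(⟪ℓ, d s⟫ * ⟪ℓ, e⟫) ≤ ‖d s‖ * ‖e‖ := by
      refine (neg_le_abs _).trans ?_
      rw [abs_mul]
      exact mul_le_mul h6 h5 (abs_nonneg _) (norm_nonneg _)
    have h8 := hd' s hs
    rw [← he] at h8
    rw [h1, h2]
    set z := ⟪ℓ, d s⟫
    set D := ‖d s‖ with hD
    have hD0 : 0 ≤ D := norm_nonneg _
    have h9 : D * ‖e‖ ≤ κ * D ^ 2 + θ * D := by nlinarith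
    have h10 : κ * D ^ 2 ≤ lam / 24 * D ^ 2 := by gcongr
    have hDμ : μ ≤ D := by
      apply le_of_sq_le_sq _ hD0
      nlinarith [sq_nonneg z]
    have h11 : θ * D ≤ lam / 36 * D ^ 2 := by
      have : θ * D ≤ (lam * μ / 36) * D := by gcongr; linarith
      have h' : (lam * μ / 36) * D ≤ (lam * D / 36) * D := by gcongr
      linarith
    have h12 : D ^ 2 ≤ 2 * (D ^ 2 - z ^ 2) := by nlinarith [sq_nonneg μ]
    have h13 : μ ^ 2 ≤ D ^ 2 - z ^ 2 := by nlinarith [sq_nonneg z]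
    have h14 : lam * D ^ 2 ≤ lam * (2 * (D ^ 2 - z ^ 2)) := by gcongr
    have h15 : lam * μ ^ 2 ≤ lam * (D ^ 2 - z ^ 2) := by gcongr
    nlinarith
  have hrev : ∀ r ∈ Icc 0 S, -r ∈ Icc (-S) 0 := fun r hr => ⟨by linarith [hr.2], by linarith [hr.1]⟩
  have hU : ∀ r ∈ Icc 0 S, HasDerivAt (fun r => -V (-r)) (V' (-r)) r := by
    intro r hr
    have h1 := (hV (-r) (hrev r hr)).scomp r (hasDerivAt_neg r)
    refine h1.neg.congr_deriv ?_
    simp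
  have hB : ∀ r : ℝ, HasDerivAt (fun r => -(μ ^ 2 + lam * μ ^ 2 * r / 2)) (-(lam * μ ^ 2 / 2)) r := by
    intro r
    refine ((((hasDerivAt_id r).const_mul (lam * μ ^ 2)).div_const 2).const_add (μ ^ 2)).neg.congr_deriv ?_
    simp
  have key := image_le_of_deriv_right_lt_deriv_boundary' (a := 0) (b := S)
    (fun s hs => (hU s hs).continuousAt.continuousWithinAt)
    (fun s hs => (hU s (Ico_subset_Icc_self hs)).hasDerivWithinAt)
    (B := fun r => -(μ ^ 2 + lam * μ ^ 2 * r / 2))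
    (by
      simp only [V, neg_zero, h0]
      nlinarith)
    (fun s _ => (hB s).continuousAt.continuousWithinAt)
    (fun s _ => (hB s).hasDerivWithinAt)
    (by
      intro r hr heq
      have hr0 : 0 ≤ lam * μ ^ 2 * r := mul_nonneg (by positivity) hr.1
      have := hV' (-r) (hrev r (Ico_subset_Icc_self hr)) (by linarith)
      have : 0 < lam * μ ^ 2 := by positivity
      linarith)
  have h1 := key (right_mem_Icc.2 hS)
  have h2 := hM (-S) (hrev S (right_mem_Icc.2 hS))
  have h3 : V (-S) ≤ M ^ 2 := by
    simp only [V]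
    nlinarith [sq_nonneg ⟪ℓ, d (-S)⟫, norm_nonneg (d (-S))]
  nlinarith [sq_nonneg μ]

end Comparison

section Regularity

theorem hasFDerivAt_slice {E F : Type*} [NormedAddCommGroup E] [NormedSpace ℝ E]
    [NormedAddCommGroup F] [NormedSpace ℝ F] {I : Set ℝ} {g : ℝ → E → F} {t : ℝ} {x : E}
    (hg : DifferentiableWithinAt ℝ (Function.uncurry g) (I ×ˢ univ) (t, x)) (ht : t ∈ I) :
    HasFDerivAt (g t) ((fderivWithin ℝ (Function.uncurry g) (I ×ˢ univ) (t, x)).comp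
      (ContinuousLinearMap.inr ℝ ℝ E)) x := by
  have h2 : HasFDerivWithinAt (fun x : E => (t, x)) (ContinuousLinearMap.inr ℝ ℝ E) univ x :=
    (hasFDerivAt_prodMk_right t x).hasFDerivWithinAt
  have h3 := HasFDerivWithinAt.comp x (hg.hasFDerivWithinAt) h2
    (fun z _ => ⟨ht, mem_univ _⟩)
  exact hasFDerivWithinAt_univ.1 h3

theorem uniqueDiffOn_Icc_prod_univ {E : Type*} [NormedAddCommGroup E] [NormedSpace ℝ E]
    {T : ℝ} (hT : 0 < T) : UniqueDiffOn ℝ (Icc 0 T ×ˢ (univ : Set E)) :=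
  (uniqueDiffOn_Icc hT).prod uniqueDiffOn_univ

theorem continuousOn_fderiv_slice {E F : Type*} [NormedAddCommGroup E] [NormedSpace ℝ E]
    [NormedAddCommGroup F] [NormedSpace ℝ F] {T : ℝ} (hT : 0 < T) {g : ℝ → E → F}
    (hg : ContDiffOn ℝ 1 (Function.uncurry g) (Icc 0 T ×ˢ univ)) :
    ContinuousOn (fun p : ℝ × E => fderiv ℝ (g p.1) p.2) (Icc 0 T ×ˢ univ) := by
  have h1 := hg.continuousOn_fderivWithin (uniqueDiffOn_Icc_prod_univ hT) (by simp)
  have h2 : ContinuousOn (fun p : ℝ × E => (fderivWithin ℝ (Function.uncurry g) (Icc 0 T ×ˢ univ)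
      p).comp (ContinuousLinearMap.inr ℝ ℝ E)) (Icc 0 T ×ˢ univ) :=
    h1.clm_comp continuousOn_const
  refine h2.congr fun p hp => ?_
  exact (hasFDerivAt_slice (hg.differentiableOn (by simp) p hp) hp.1).fderiv

theorem interior_prod_mem_nhds {E : Type*} [NormedAddCommGroup E]
    {T t : ℝ} (ht : t ∈ Ioo 0 T) (x : E) : Icc 0 T ×ˢ (univ : Set E) ∈ 𝓝 (t, x) :=
  prod_mem_nhds (Icc_mem_nhds ht.1 ht.2) univ_mem

variable {E : Type*} [NormedAddCommGroup E] [InnerProductSpace ℝ E] [CompleteSpace E]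

theorem inner_gradient_eq_fderiv (h : E → ℝ) (x v : E) : ⟪gradient h x, v⟫ = fderiv ℝ h x v := by
  simp [gradient]

theorem contDiffOn_gradient {T : ℝ} (hT : 0 < T) {f : ℝ → E → ℝ}
    (hf : ContDiffOn ℝ 3 (Function.uncurry f) (Icc 0 T ×ˢ univ)) :
    ContDiffOn ℝ 2 (Function.uncurry fun t x => gradient (f t) x) (Icc 0 T ×ˢ univ) := by
  have h1 := hf.fderivWithin (m := 2) (uniqueDiffOn_Icc_prod_univ hT) (by norm_num)
  have h2 : ContDiffOn ℝ 2 (fun p : ℝ × E => (InnerProductSpace.toDual ℝ E).symm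
      ((fderivWithin ℝ (Function.uncurry f) (Icc 0 T ×ˢ univ)
      p).comp (ContinuousLinearMap.inr ℝ ℝ E))) (Icc 0 T ×ˢ univ) :=
    (InnerProductSpace.toDual ℝ E).symm.contDiff.comp_contDiffOn (h1.clm_comp contDiffOn_const)
  refine h2.congr fun p hp => ?_
  have := (hasFDerivAt_slice (g := f) (hf.differentiableOn (by simp) p hp) hp.1).fderiv
  simp only [Function.uncurry, gradient]
  rw [this]

theorem contDiff_slice {E F : Type*} [NormedAddCommGroup E] [NormedSpace ℝ E]
    [NormedAddCommGroup F] [NormedSpace ℝ F] {I : Set ℝ}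
    {m : WithTop ℕ∞} {f : ℝ → E → F} (hf : ContDiffOn ℝ m (Function.uncurry f) (I ×ˢ univ))
    {t : ℝ} (ht : t ∈ I) : ContDiff ℝ m (f t) := by
  rw [← contDiffOn_univ]
  exact hf.comp (contDiff_prodMk_right t).contDiffOn (fun x _ => ⟨ht, mem_univ _⟩)

theorem inner_fderiv_gradient {h : E → ℝ} (hh : ContDiff ℝ 2 h) (x v w : E) :
    ⟪fderiv ℝ (gradient h) x v, w⟫ = fderiv ℝ (fderiv ℝ h) x v w := by
  have h1 : DifferentiableAt ℝ (fderiv ℝ h) x :=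
    (hh.fderiv_right (m := 1) (by norm_num)).differentiable (by simp) x
  have h2 : HasFDerivAt (gradient h) ((InnerProductSpace.toDual ℝ E).symm.toContinuousLinearEquiv.toContinuousLinearMap.comp
      (fderiv ℝ (fderiv ℝ h) x)) x :=
    (InnerProductSpace.toDual ℝ E).symm.toContinuousLinearEquiv.toContinuousLinearMap.hasFDerivAt.comp x
      h1.hasFDerivAt
  rw [h2.fderiv]
  simp

theorem inner_fderiv_gradient_comm {h : E → ℝ} (hh : ContDiff ℝ 2 h) (x v w : E) :
    ⟪fderiv ℝ (gradient h) x v, w⟫ = ⟪v, fderiv ℝ (gradient h) x w⟫ := by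
  rw [real_inner_comm (fderiv ℝ (gradient h) x w), inner_fderiv_gradient hh, inner_fderiv_gradient hh]
  exact (hh.contDiffAt.isSymmSndFDerivAt (by simp)).eq v w

theorem fderiv_fderiv_apply_eq_deriv_deriv {V : Type*} [NormedAddCommGroup V] [NormedSpace ℝ V]
    {h : V → ℝ} {p : V} (hh : ContDiffAt ℝ 2 h p) (v : V) :
    fderiv ℝ (fderiv ℝ h) p v v = deriv (deriv fun s : ℝ => h (p + s • v)) 0 := by
  have hline : ∀ s : ℝ, HasDerivAt (fun s : ℝ => p + s • v) v s := fun s => by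
    simpa using ((hasDerivAt_id s).smul_const v).const_add p
  have hcont : Tendsto (fun s : ℝ => p + s • v) (𝓝 0) (𝓝 p) := by
    have := (hline 0).continuousAt.tendsto
    rwa [zero_smul, add_zero] at this
  have h1 : deriv (fun s : ℝ => h (p + s • v)) =ᶠ[𝓝 0] fun s => fderiv ℝ h (p + s • v) v := by
    filter_upwards [hcont.eventually (hh.eventually (by simp))] with s hs
    exact ((hs.differentiableAt (by simp)).hasFDerivAt.comp_hasDerivAt s (hline s)).deriv
  rw [h1.deriv_eq]
  have h2 : HasFDerivAt (fderiv ℝ h) (fderiv ℝ (fderiv ℝ h) p) (p + (0 : ℝ) • v) := by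
    rw [zero_smul, add_zero]
    exact ((hh.fderiv_right (m := 1) (by norm_num)).differentiableAt (by simp)).hasFDerivAt
  have h3 : HasDerivAt (fun s : ℝ => fderiv ℝ h (p + s • v)) (fderiv ℝ (fderiv ℝ h) p v) 0 :=
    h2.comp_hasDerivAt (0 : ℝ) (hline 0)
  have h4 := h3.clm_apply (hasDerivAt_const (0 : ℝ) v)
  rw [h4.deriv, map_zero, add_zero]

theorem fderiv_fderiv_inner_gradient {n : ℕ} {T : ℝ} (hT : 0 < T)
    {f : ℝ → EuclideanSpace ℝ (Fin n) → ℝ}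
    (hf : ContDiffOn ℝ 3 (Function.uncurry f) (Icc 0 T ×ˢ univ)) {t : ℝ} (ht : t ∈ Ioo 0 T)
    (x ℓ : EuclideanSpace ℝ (Fin n)) :
    fderiv ℝ (fderiv ℝ fun p : ℝ × EuclideanSpace ℝ (Fin n) => ⟪ℓ, gradient (f p.1) p.2⟫) (t, x)
      (0, ℓ) (0, ℓ) = thirdDeriv f t x ℓ := by
  have hg := contDiffOn_gradient hT hf
  have hφ : ContDiffAt ℝ 2 (fun p : ℝ × EuclideanSpace ℝ (Fin n) => ⟪ℓ, gradient (f p.1) p.2⟫)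
      (t, x) :=
    contDiffAt_const.inner ℝ (hg.contDiffAt (interior_prod_mem_nhds ht x))
  have hft : ContDiff ℝ 3 (f t) := contDiff_slice hf (Ioo_subset_Icc_self ht)
  have hφt : ContDiff ℝ 2 (fun z => fderiv ℝ (f t) z ℓ) :=
    (hft.fderiv_right (m := 2) (by norm_num)).clm_apply contDiff_const
  rw [fderiv_fderiv_apply_eq_deriv_deriv hφ]
  have e1 : (fun s : ℝ => (fun p : ℝ × EuclideanSpace ℝ (Fin n) => ⟪ℓ, gradient (f p.1) p.2⟫)
      ((t, x) + s • ((0 : ℝ), ℓ))) = fun s : ℝ => (fun z => fderiv ℝ (f t) z ℓ) (x + s • ℓ) := by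
    funext s
    simp only [Prod.fst_add, Prod.snd_add, Prod.smul_fst, Prod.smul_snd, smul_zero, add_zero]
    rw [real_inner_comm, inner_gradient_eq_fderiv]
  rw [e1, ← fderiv_fderiv_apply_eq_deriv_deriv hφt.contDiffAt, thirdDeriv]
  rw [iteratedFDeriv_succ_apply_right]
  have e2 : (fun z => fderiv ℝ (f t) z ℓ) =
      (ContinuousLinearMap.apply ℝ ℝ ℓ) ∘ (fderiv ℝ (f t)) := rfl
  have e3 := (ContinuousLinearMap.apply ℝ ℝ ℓ).iteratedFDeriv_comp_left (i := 2)
    ((hft.fderiv_right (m := 2) (by norm_num)).contDiffAt (x := x)) le_rfl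
  have e4 := congrArg (fun m => m ![ℓ, ℓ]) e3
  simp only [ContinuousLinearMap.compContinuousMultilinearMap_coe, Function.comp_apply,
    ContinuousLinearMap.apply_apply] at e4
  rw [← e2, iteratedFDeriv_two_apply] at e4
  simp only [Matrix.cons_val_zero, Matrix.cons_val_one] at e4
  rw [e4]
  congr 2
  ext i
  fin_cases i <;> rfl

theorem fderiv_inner_gradient_time {n : ℕ} {T : ℝ}
    {f : ℝ → EuclideanSpace ℝ (Fin n) → ℝ}
    (hf : ContDiffOn ℝ 3 (Function.uncurry f) (Icc 0 T ×ˢ univ)) {t : ℝ} (ht : t ∈ Ioo 0 T)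
    (x ℓ : EuclideanSpace ℝ (Fin n)) :
    fderiv ℝ (fun p : ℝ × EuclideanSpace ℝ (Fin n) => ⟪ℓ, gradient (f p.1) p.2⟫) (t, x)
      (1, 0) = ⟪gradft f t x, ℓ⟫ := by
  set F := Function.uncurry f with hF
  have hFat : ∀ t ∈ Ioo 0 T, ∀ z, ContDiffAt ℝ 3 F (t, z) := fun t ht z =>
    hf.contDiffAt (interior_prod_mem_nhds ht z)
  have hFd : DifferentiableAt ℝ (fderiv ℝ F) (t, x) :=
    ((hFat t ht x).fderiv_right (m := 2) (by norm_num)).differentiableAt (by simp)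
  have e1 : (fun p : ℝ × EuclideanSpace ℝ (Fin n) => ⟪ℓ, gradient (f p.1) p.2⟫) =ᶠ[𝓝 (t, x)]
      fun p => fderiv ℝ F p (0, ℓ) := by
    filter_upwards [prod_mem_nhds (Ioo_mem_nhds ht.1 ht.2) univ_mem] with p hp
    rw [real_inner_comm, inner_gradient_eq_fderiv]
    have h1 := ((hFat p.1 hp.1 p.2).differentiableAt (by simp)).hasFDerivAt.comp p.2
      (hasFDerivAt_prodMk_right p.1 p.2)
    have h2 : fderiv ℝ (f p.1) p.2 = _ := h1.fderiv
    rw [h2]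
    simp
  rw [e1.fderiv_eq]
  have e2 : (fun z => deriv (fun s => f s z) t) = fun z => fderiv ℝ F (t, z) (1, 0) := by
    funext z
    have h1 := HasFDerivAt.comp (f := fun s : ℝ => (s, z)) t
      ((hFat t ht z).differentiableAt (by simp)).hasFDerivAt (hasFDerivAt_prodMk_left t z)
    have h2 := h1.hasDerivAt.deriv
    simpa [F, Function.comp_def, Function.uncurry] using h2
  rw [gradft, inner_gradient_eq_fderiv, e2]
  have h3 := (hFd.hasFDerivAt.comp x (hasFDerivAt_prodMk_right t x)).clm_apply
    (hasFDerivAt_const ((1 : ℝ), (0 : EuclideanSpace ℝ (Fin n))) x)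
  have h4 := hFd.hasFDerivAt.clm_apply
    (hasFDerivAt_const ((0 : ℝ), ℓ) (t, x))
  have h5 := ((hFat t ht x).isSymmSndFDerivAt (by simp; norm_num)).eq ((1 : ℝ), (0 : EuclideanSpace ℝ (Fin n)))
    ((0 : ℝ), ℓ)
  rw [show (fun z => fderiv ℝ F (t, z) (1, 0)) = fun z => (fderiv ℝ F ∘ fun z => (t, z)) z (1, 0)
    from rfl, h3.fderiv, h4.fderiv]
  simpa using h5

end Regularity

section Stability

theorem continuousOn_slice_time {E F : Type*} [TopologicalSpace E] [TopologicalSpace F]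
    {f : ℝ → E → F} {I : Set ℝ}
    (hf : ContinuousOn (Function.uncurry f) (I ×ˢ univ)) (x : E) :
    ContinuousOn (fun t => f t x) I :=
  hf.comp (f := fun t => (t, x)) (by fun_prop) (fun _ ht => ⟨ht, mem_univ _⟩)

variable {E : Type*} [NormedAddCommGroup E] [InnerProductSpace ℝ E]

/-- `w` solves `ε w' = -g(s, w)` on `[a, b]`, the derivatives being taken from the right. -/
def IsSlowFlow (g : ℝ → E → E) (ε a b : ℝ) (w : ℝ → E) : Prop :=
  ContinuousOn w (Icc a b) ∧ ∀ s ∈ Ico a b, HasDerivWithinAt w (-(ε⁻¹ • g s (w s))) (Ici s) s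

theorem IsSlowFlow.mono {g : ℝ → E → E} {ε a b a' b' : ℝ} {w : ℝ → E}
    (hw : IsSlowFlow g ε a b w) (ha : a ≤ a') (hb : b' ≤ b) : IsSlowFlow g ε a' b' w :=
  ⟨hw.1.mono (Icc_subset_Icc ha hb), fun s hs => hw.2 s ⟨ha.trans hs.1, hs.2.trans_le hb⟩⟩

theorem isSlowFlow_of_hasDerivWithinAt {g : ℝ → E → E} {ε T : ℝ} {w : ℝ → E}
    (h : ∀ s ∈ Icc 0 T, HasDerivWithinAt w (-(ε⁻¹ • g s (w s))) (Icc 0 T) s) :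
    IsSlowFlow g ε 0 T w := by
  refine ⟨fun s hs => (h s hs).continuousWithinAt, fun s hs => ?_⟩
  refine (h s (Ico_subset_Icc_self hs)).mono_of_mem_nhdsWithin ?_
  exact mem_of_superset (Icc_mem_nhdsGE hs.2) (Icc_subset_Icc_left hs.1)

/-- The derivative of a slice is a uniformly good linear approximation near a point. -/
theorem exists_norm_sub_sub_fderiv_le {T : ℝ} (hT : 0 < T) {g : ℝ → E → E}
    (hg : ContDiffOn ℝ 1 (Function.uncurry g) (Icc 0 T ×ˢ univ)) {t₀ : ℝ} (ht₀ : t₀ ∈ Icc 0 T)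
    (ξ : E) {κ : ℝ} (hκ : 0 < κ) :
    ∃ r > 0, ∀ t ∈ Icc 0 T, |t - t₀| ≤ r → ∀ x ∈ Metric.closedBall ξ r,
      ∀ x' ∈ Metric.closedBall ξ r,
        ‖g t x - g t x' - fderiv ℝ (g t₀) ξ (x - x')‖ ≤ κ * ‖x - x'‖ := by
  have hH := continuousOn_fderiv_slice hT hg (t₀, ξ) ⟨ht₀, mem_univ _⟩
  obtain ⟨δ, hδ, hb⟩ := Metric.continuousWithinAt_iff.1 hH κ hκ
  refine ⟨δ / 2, by positivity, fun t ht htt x hx x' hx' => ?_⟩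
  have hd : ∀ z ∈ Metric.closedBall ξ (δ / 2),
      HasFDerivWithinAt (g t) (fderiv ℝ (g t) z) (Metric.closedBall ξ (δ / 2)) z := fun z _ =>
    (hasFDerivAt_slice (hg.differentiableOn (by simp) (t, z) ⟨ht, mem_univ _⟩)
      ht).differentiableAt.hasFDerivAt.hasFDerivWithinAt
  refine (convex_closedBall ξ (δ / 2)).norm_image_sub_le_of_norm_hasFDerivWithin_le' hd
    (fun z hz => ?_) hx' hx
  have := hb (x := (t, z)) ⟨ht, mem_univ _⟩ (by
    rw [Prod.dist_eq, max_lt_iff, Real.dist_eq]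
    exact ⟨by linarith, by rw [Metric.mem_closedBall] at hz; linarith⟩)
  rw [dist_eq_norm] at this
  exact this.le

theorem exists_coercive_of_pos [FiniteDimensional ℝ E] (A : E →L[ℝ] E) (W : Submodule ℝ E)
    (hW : ∀ v ∈ W, v ≠ 0 → 0 < ⟪v, A v⟫) :
    ∃ lam > 0, ∀ v ∈ W, lam * ‖v‖ ^ 2 ≤ ⟪v, A v⟫ := by
  have hcomp : IsCompact (Metric.sphere (0 : E) 1 ∩ W) :=
    (isCompact_sphere 0 1).inter_right W.closed_of_finiteDimensional
  have hcont : Continuous fun v : E => ⟪v, A v⟫ := by fun_prop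
  obtain ⟨lam, hlam, hle⟩ : ∃ lam > 0, ∀ v ∈ Metric.sphere (0 : E) 1 ∩ W, lam ≤ ⟪v, A v⟫ := by
    rcases (Metric.sphere (0 : E) 1 ∩ W).eq_empty_or_nonempty with h | h
    · exact ⟨1, one_pos, by simp [h]⟩
    · obtain ⟨v, hv, hmin⟩ := hcomp.exists_isMinOn h hcont.continuousOn
      refine ⟨⟪v, A v⟫, hW v hv.2 ?_, fun w hw => hmin hw⟩
      rintro rfl
      simp at hv
  refine ⟨lam, hlam, fun v hv => ?_⟩
  rcases eq_or_ne v 0 with rfl | h0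
  · simp
  · have hn : ‖v‖ ≠ 0 := norm_ne_zero_iff.2 h0
    have := hle (‖v‖⁻¹ • v) ⟨by simp [norm_smul, hn], W.smul_mem _ hv⟩
    rw [map_smul, inner_smul_left, inner_smul_right] at this
    simp only [RCLike.conj_to_real] at this
    have h2 : ‖v‖⁻¹ * (‖v‖⁻¹ * ⟪v, A v⟫) = ⟪v, A v⟫ / ‖v‖ ^ 2 := by field_simp
    rwa [h2, le_div_iff₀ (by positivity)] at this

variable [FiniteDimensional ℝ E] {T : ℝ} {g : ℝ → E → E}

theorem exists_strongly_monotone (hT : 0 < T)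
    (hg : ContDiffOn ℝ 1 (Function.uncurry g) (Icc 0 T ×ˢ univ)) {t₀ : ℝ} (ht₀ : t₀ ∈ Icc 0 T)
    {ξ : E} (hpd : ∀ v ≠ 0, 0 < ⟪fderiv ℝ (g t₀) ξ v, v⟫) :
    ∃ r > 0, ∃ lam > 0, ∀ t ∈ Icc 0 T, |t - t₀| ≤ r → ∀ x ∈ Metric.closedBall ξ r,
      ∀ x' ∈ Metric.closedBall ξ r, lam * ‖x - x'‖ ^ 2 ≤ ⟪x - x', g t x - g t x'⟫ := by
  obtain ⟨lam, hlam, hA⟩ := exists_coercive_of_pos (fderiv ℝ (g t₀) ξ) ⊤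
    (fun v _ hv => by rw [real_inner_comm]; exact hpd v hv)
  obtain ⟨r, hr, h⟩ := exists_norm_sub_sub_fderiv_le hT hg ht₀ ξ (half_pos hlam)
  refine ⟨r, hr, lam / 2, half_pos hlam, fun t ht htt x hx x' hx' => ?_⟩
  have h1 := h t ht htt x hx x' hx'
  have h2 := hA (x - x') trivial
  set e := g t x - g t x' - fderiv ℝ (g t₀) ξ (x - x') with he
  have h3 : g t x - g t x' = e + fderiv ℝ (g t₀) ξ (x - x') := by rw [he]; abel
  rw [h3, inner_add_right]
  have h4 := abs_le.1 ((abs_real_inner_le_norm (x - x') e).trans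
    (mul_le_mul_of_nonneg_left h1 (norm_nonneg _)))
  nlinarith [h4.1]

/-- Small balls around a nondegenerate minimum are forward invariant for a short time, uniformly
in `ε`. -/
theorem exists_ball_invariant (hT : 0 < T)
    (hg : ContDiffOn ℝ 1 (Function.uncurry g) (Icc 0 T ×ˢ univ)) {t₀ : ℝ} (ht₀ : t₀ ∈ Icc 0 T)
    {ξ : E} (hξ : g t₀ ξ = 0) (hpd : ∀ v ≠ 0, 0 < ⟪fderiv ℝ (g t₀) ξ v, v⟫) :
    ∃ R > 0, ∀ η, 0 < η → η ≤ R → ∃ δ > 0, ∀ ε > 0, ∀ a b, 0 ≤ a → b ≤ T → t₀ - δ ≤ a →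
      b ≤ t₀ + δ → ∀ w, IsSlowFlow g ε a b w → ‖w a - ξ‖ ≤ η → ∀ s ∈ Icc a b, ‖w s - ξ‖ ≤ η := by
  obtain ⟨R, hR, lam, hlam, hmono⟩ := exists_strongly_monotone hT hg ht₀ hpd
  refine ⟨R, hR, fun η hη hηR => ?_⟩
  have hc := continuousOn_slice_time hg.continuousOn ξ t₀ ht₀
  obtain ⟨δ, hδ, hb⟩ := Metric.continuousWithinAt_iff.1 hc (lam * η) (by positivity)
  refine ⟨min (δ / 2) R, by positivity, fun ε hε a b ha hb' hta htb w hw hwa => ?_⟩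
  have key := image_le_of_deriv_right_lt_deriv_boundary' (a := a) (b := b)
    (f := fun s => ‖w s - ξ‖ ^ 2) (f' := fun s => 2 * ⟪w s - ξ, -(ε⁻¹ • g s (w s))⟫)
    ((hw.1.sub continuousOn_const).norm.pow 2)
    (fun s hs => ((hw.2 s hs).sub_const ξ).norm_sq)
    (B := fun _ => η ^ 2) (B' := fun _ => 0)
    (pow_le_pow_left₀ (norm_nonneg _) hwa 2) continuousOn_const
    (fun s _ => hasDerivWithinAt_const _ _ _) ?_
  · intro s hs
    exact le_of_sq_le_sq (key hs) hη.le
  · intro s hs heq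
    have hn : ‖w s - ξ‖ = η := (pow_left_inj₀ (norm_nonneg _) hη.le two_ne_zero).1 heq
    have hs0 : s ∈ Icc 0 T := ⟨ha.trans hs.1, hs.2.le.trans hb'⟩
    have hst : |s - t₀| ≤ min (δ / 2) R :=
      abs_le.2 ⟨by linarith [hs.1], by linarith [hs.2]⟩
    have h1 := hmono s hs0 (hst.trans (min_le_right _ _)) (w s)
      (by rw [Metric.mem_closedBall, dist_eq_norm, hn]; exact hηR) ξ
      (Metric.mem_closedBall_self hR.le)
    have h2 := hb hs0 (by
      rw [Real.dist_eq]
      exact (hst.trans (min_le_left _ _)).trans_lt (by linarith))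
    rw [dist_eq_norm, hξ, sub_zero] at h2
    rw [inner_sub_right, hn] at h1
    have h3 : -⟪w s - ξ, g s ξ⟫ < η * (lam * η) := by
      refine (neg_le_abs _).trans_lt ((abs_real_inner_le_norm _ _).trans_lt ?_)
      rw [hn]
      gcongr
    rw [inner_neg_right, inner_smul_right]
    have : 0 < ε⁻¹ * ⟪w s - ξ, g s (w s)⟫ := mul_pos (by positivity) (by nlinarith)
    linarith

theorem exists_uniform_coercive (hT : 0 < T)
    (hg : ContDiffOn ℝ 1 (Function.uncurry g) (Icc 0 T ×ˢ univ)) {a b : ℝ} (ha : 0 ≤ a)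
    (hb : b ≤ T) {U : ℝ → E} (hU : ContinuousOn U (Icc a b))
    (hcrit : ∀ s ∈ Icc a b, g s (U s) = 0)
    (hpd : ∀ s ∈ Icc a b, ∀ v ≠ 0, 0 < ⟪fderiv ℝ (g s) (U s) v, v⟫) :
    ∃ r > 0, ∃ lam > 0, ∀ s ∈ Icc a b, ∀ x, ‖x - U s‖ ≤ r →
      lam * ‖x - U s‖ ^ 2 ≤ ⟪x - U s, g s x⟫ := by
  refine (isCompact_Icc (a := a) (b := b)).induction_on
    (p := fun K => ∃ r > 0, ∃ lam > 0, ∀ s ∈ K, ∀ x, ‖x - U s‖ ≤ r →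
      lam * ‖x - U s‖ ^ 2 ≤ ⟪x - U s, g s x⟫) ?_ ?_ ?_ ?_
  · exact ⟨1, one_pos, 1, one_pos, by simp⟩
  · rintro K K' hKK ⟨r, hr, lam, hlam, h⟩
    exact ⟨r, hr, lam, hlam, fun s hs => h s (hKK hs)⟩
  · rintro K K' ⟨r, hr, lam, hlam, h⟩ ⟨r', hr', lam', hlam', h'⟩
    refine ⟨min r r', lt_min hr hr', min lam lam', lt_min hlam hlam', fun s hs x hx => ?_⟩
    rcases hs with hs | hs
    · refine le_trans ?_ (h s hs x (hx.trans (min_le_left _ _)))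
      gcongr
      exact min_le_left _ _
    · refine le_trans ?_ (h' s hs x (hx.trans (min_le_right _ _)))
      gcongr
      exact min_le_right _ _
  · intro s₀ hs₀
    obtain ⟨r, hr, lam, hlam, hm⟩ :=
      exists_strongly_monotone hT hg ⟨ha.trans hs₀.1, hs₀.2.trans hb⟩ (hpd s₀ hs₀)
    have h1 : ∀ᶠ s in 𝓝[Icc a b] s₀, ‖U s - U s₀‖ < r / 2 := by
      have := (hU s₀ hs₀).eventually (Metric.ball_mem_nhds (U s₀) (half_pos hr))
      simpa only [Metric.mem_ball, dist_eq_norm] using this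
    have h2 : ∀ᶠ s in 𝓝[Icc a b] s₀, |s - s₀| < r := by
      have := mem_nhdsWithin_of_mem_nhds (t := Icc a b) (Metric.ball_mem_nhds s₀ hr)
      filter_upwards [this] with s hs
      rwa [Metric.mem_ball, Real.dist_eq] at hs
    refine ⟨_, h1.and (h2.and self_mem_nhdsWithin), r / 2, half_pos hr, lam, hlam, ?_⟩
    rintro s ⟨hs1, hs2, hs3⟩ x hx
    have hxs : ‖x - U s₀‖ ≤ r := by
      have : x - U s₀ = (x - U s) + (U s - U s₀) := by abel
      rw [this]
      exact (norm_add_le _ _).trans (by linarith)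
    have := hm s ⟨ha.trans hs3.1, hs3.2.trans hb⟩ hs2.le x (by simpa [dist_eq_norm] using hxs)
      (U s) (by rw [mem_closedBall_iff_norm]; linarith)
    rwa [hcrit s hs3, sub_zero] at this

/-- Solutions starting close to a branch of nondegenerate minima stay close to it. -/
theorem exists_tracking (hT : 0 < T)
    (hg : ContDiffOn ℝ 1 (Function.uncurry g) (Icc 0 T ×ˢ univ)) {a b c : ℝ} (ha : 0 ≤ a)
    (hbc : b < c) (hb : b ≤ T) {U : ℝ → E} (hU : ContDiffOn ℝ 1 U (Ico a c))
    (hcrit : ∀ s ∈ Ico a c, g s (U s) = 0)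
    (hpd : ∀ s ∈ Ico a c, ∀ v ≠ 0, 0 < ⟪fderiv ℝ (g s) (U s) v, v⟫) :
    ∃ R > 0, ∀ η, 0 < η → η ≤ R → ∃ ε₀ > 0, ∀ ε, 0 < ε → ε < ε₀ → ∀ w, ∀ a' b', a ≤ a' → b' ≤ b →
      IsSlowFlow g ε a' b' w → ‖w a' - U a'‖ ≤ η → ∀ s ∈ Icc a' b', ‖w s - U s‖ ≤ η := by
  have hsub : Icc a b ⊆ Ico a c := fun s hs => ⟨hs.1, hs.2.trans_lt hbc⟩
  obtain ⟨R, hR, lam, hlam, hco⟩ := exists_uniform_coercive hT hg ha hb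
    (hU.continuousOn.mono hsub) (fun s hs => hcrit s (hsub hs)) (fun s hs => hpd s (hsub hs))
  obtain ⟨M, hM⟩ : ∃ M, ∀ s ∈ Icc a b, ‖derivWithin U (Ico a c) s‖ ≤ M := by
    rcases lt_or_ge b a with h | h
    · exact ⟨0, by simp [h]⟩
    · exact isCompact_Icc.exists_bound_of_continuousOn
        ((hU.continuousOn_derivWithin (uniqueDiffOn_Ico a c) le_rfl).mono hsub)
  refine ⟨R, hR, fun η hη hηR => ?_⟩
  refine ⟨lam * η / (|M| + 1), by positivity, fun ε hε hε₀ w a' b' ha' hb' hw hwa => ?_⟩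
  have hUd : ∀ s ∈ Ico a' b', HasDerivWithinAt U (derivWithin U (Ico a c) s) (Ici s) s := by
    intro s hs
    have hs' : s ∈ Ico a c := ⟨ha'.trans hs.1, hs.2.trans_le (hb'.trans hbc.le)⟩
    refine ((hU.differentiableOn (by simp)) s hs').hasDerivWithinAt.mono_of_mem_nhdsWithin ?_
    exact mem_of_superset (Ico_mem_nhdsGE hs'.2) (Ico_subset_Ico_left hs'.1)
  have key := image_le_of_deriv_right_lt_deriv_boundary' (a := a') (b := b')
    (f := fun s => ‖w s - U s‖ ^ 2)
    (f' := fun s => 2 * ⟪w s - U s, -(ε⁻¹ • g s (w s)) - derivWithin U (Ico a c) s⟫)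
    ((hw.1.sub (hU.continuousOn.mono fun s hs =>
      ⟨ha'.trans hs.1, hs.2.trans_lt (hb'.trans_lt hbc)⟩)).norm.pow 2)
    (fun s hs => ((hw.2 s hs).sub (hUd s hs)).norm_sq)
    (B := fun _ => η ^ 2) (B' := fun _ => 0)
    (pow_le_pow_left₀ (norm_nonneg _) hwa 2) continuousOn_const
    (fun s _ => hasDerivWithinAt_const _ _ _) ?_
  · intro s hs
    exact le_of_sq_le_sq (key hs) hη.le
  · intro s hs heq
    have hn : ‖w s - U s‖ = η := (pow_left_inj₀ (norm_nonneg _) hη.le two_ne_zero).1 heq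
    have hs0 : s ∈ Icc a b := ⟨ha'.trans hs.1, hs.2.le.trans hb'⟩
    have h1 := hco s hs0 (w s) (hn.le.trans hηR)
    rw [hn] at h1
    have h3 : -⟪w s - U s, derivWithin U (Ico a c) s⟫ ≤ η * |M| := by
      refine (neg_le_abs _).trans ((abs_real_inner_le_norm _ _).trans ?_)
      rw [hn]
      gcongr
      exact (hM s hs0).trans (le_abs_self M)
    rw [inner_sub_right, inner_neg_right, inner_smul_right]
    have h4 : ε⁻¹ * (lam * η ^ 2) ≤ ε⁻¹ * ⟪w s - U s, g s (w s)⟫ := by gcongr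
    have h5 : η * |M| < ε⁻¹ * (lam * η ^ 2) := by
      rw [lt_div_iff₀ (by positivity)] at hε₀
      rw [← div_eq_inv_mul, lt_div_iff₀ hε]
      nlinarith [abs_nonneg M]
    linarith

end Stability

section Fold

variable {E : Type*} [NormedAddCommGroup E] [InnerProductSpace ℝ E]

theorem norm_sub_inner_smul_sq {ℓ : E} (hℓ : ‖ℓ‖ = 1) (d : E) :
    ‖d - ⟪ℓ, d⟫ • ℓ‖ ^ 2 = ‖d‖ ^ 2 - ⟪ℓ, d⟫ ^ 2 := by
  rw [norm_sub_sq_real, inner_smul_right, real_inner_comm, norm_smul, hℓ, Real.norm_eq_abs,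
    mul_one, sq_abs]
  ring

theorem norm_le_abs_add_norm_sub {ℓ : E} (hℓ : ‖ℓ‖ = 1) (d : E) :
    ‖d‖ ≤ |⟪ℓ, d⟫| + ‖d - ⟪ℓ, d⟫ • ℓ‖ := by
  have h : d = ⟪ℓ, d⟫ • ℓ + (d - ⟪ℓ, d⟫ • ℓ) := by abel
  calc ‖d‖ = ‖⟪ℓ, d⟫ • ℓ + (d - ⟪ℓ, d⟫ • ℓ)‖ := by rw [← h]
    _ ≤ ‖⟪ℓ, d⟫ • ℓ‖ + ‖d - ⟪ℓ, d⟫ • ℓ‖ := norm_add_le _ _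
    _ = _ := by rw [norm_smul, hℓ, mul_one, Real.norm_eq_abs]

theorem abs_inner_le_norm_of_unit {ℓ : E} (hℓ : ‖ℓ‖ = 1) (d : E) : |⟪ℓ, d⟫| ≤ ‖d‖ := by
  simpa [hℓ] using abs_real_inner_le_norm ℓ d

theorem exists_abs_apply_apply_le {V : Type*} [NormedAddCommGroup V] [NormedSpace ℝ V]
    (B : V →L[ℝ] V →L[ℝ] ℝ) : ∃ b, 0 ≤ b ∧ ∀ v w, |B v w| ≤ b * ‖v‖ * ‖w‖ :=
  ⟨‖B‖, B.opNorm_nonneg, fun v w => B.le_opNorm₂ v w⟩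

theorem fold_remainder_le {ϑ b κ r C S Z N : ℝ} (hϑ : 0 < ϑ) (hb : 0 ≤ b) (hκ : 0 ≤ κ)
    (hκ1 : κ ≤ 1) (hκb : 2 * b * κ ≤ ϑ / 2) (hC : 0 ≤ C)
    (hr : r * (b * (C + C ^ 2) + ϑ / 3 * C ^ 2) ≤ ϑ) (hS : 0 ≤ S) (hSr : S ≤ r) (hZ : 0 ≤ Z)
    (hZr : Z ≤ r) (hN : 0 ≤ N) (hNle : N ≤ C * S + κ * Z) :
    ϑ / 12 * (2 * Z ^ 2 + 2 * N ^ 2) + 1 / 2 * (b * (2 * (Z * N) + N ^ 2)) ≤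
      ϑ * (S + Z ^ 2) := by
  have hzN : Z * N ≤ C * r * S + κ * Z ^ 2 := by
    calc Z * N ≤ Z * (C * S + κ * Z) := by gcongr
      _ = C * Z * S + κ * Z ^ 2 := by ring
      _ ≤ C * r * S + κ * Z ^ 2 := by gcongr
  have hN2 : N ^ 2 ≤ 2 * C ^ 2 * r * S + 2 * κ * Z ^ 2 := by
    calc N ^ 2 ≤ (C * S + κ * Z) ^ 2 := by gcongr
      _ ≤ 2 * C ^ 2 * S * S + 2 * (κ * κ) * Z ^ 2 := by
        linarith [sq_nonneg (C * S - κ * Z)]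
      _ ≤ 2 * C ^ 2 * r * S + 2 * (κ * 1) * Z ^ 2 := by gcongr
      _ = _ := by ring
  have h6 : ϑ / 12 * N ^ 2 ≤ ϑ / 12 * (2 * C ^ 2 * r * S + 2 * κ * Z ^ 2) := by gcongr
  have h61 : ϑ / 12 * (2 * κ * Z ^ 2) ≤ ϑ / 12 * (2 * 1 * Z ^ 2) := by gcongr
  have h7 : b * (Z * N) ≤ b * (C * r * S + κ * Z ^ 2) := by gcongr
  have h8 : b * N ^ 2 ≤ b * (2 * C ^ 2 * r * S + 2 * κ * Z ^ 2) := by gcongr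
  have h9 : r * (b * (C + C ^ 2) + ϑ / 3 * C ^ 2) * S ≤ ϑ * S := by gcongr
  have h10 : 2 * b * κ * Z ^ 2 ≤ ϑ / 2 * Z ^ 2 := by gcongr
  linarith

/-- Normal form of a function of `(t, x)` near a fold point, in a region where the component
orthogonal to `ℓ` is dominated. -/
theorem exists_fold_expansion {φ : ℝ × E → ℝ} {τ : ℝ} {ξ ℓ : E}
    (hφ : ContDiffAt ℝ 2 φ (τ, ξ)) (hφ0 : φ (τ, ξ) = 0)
    (hφx : ∀ v, fderiv ℝ φ (τ, ξ) (0, v) = 0) (hℓ : ‖ℓ‖ = 1) {C ϑ : ℝ} (hC : 0 ≤ C)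
    (hϑ : 0 < ϑ) :
    ∃ κ > 0, ∃ r > 0, ∀ s : ℝ, ∀ d : E, |s| ≤ r → ‖d‖ ≤ r →
      ‖d - ⟪ℓ, d⟫ • ℓ‖ ≤ C * |s| + κ * |⟪ℓ, d⟫| →
      |φ (τ + s, ξ + d) - fderiv ℝ φ (τ, ξ) (1, 0) * s -
        fderiv ℝ (fderiv ℝ φ) (τ, ξ) (0, ℓ) (0, ℓ) / 2 * ⟪ℓ, d⟫ ^ 2| ≤
        ϑ * (|s| + ⟪ℓ, d⟫ ^ 2) := by
  obtain ⟨r₀, hr₀, htay⟩ := Metric.eventually_nhds_iff_ball.1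
    (hφ.eventually_taylor_two (ϑ := ϑ / 12) (by positivity))
  set B := fderiv ℝ (fderiv ℝ φ) (τ, ξ) with hB
  obtain ⟨b, hb0, hbB⟩ := exists_abs_apply_apply_le B
  obtain ⟨κ, hκ, hκ1, hκb⟩ : ∃ κ > 0, κ ≤ 1 ∧ 2 * b * κ ≤ ϑ / 2 := by
    refine ⟨min 1 (ϑ / (4 * (b + 1))), by positivity, min_le_left _ _, ?_⟩
    have h1 : 2 * b * min 1 (ϑ / (4 * (b + 1))) ≤ 2 * b * (ϑ / (4 * (b + 1))) := by
      gcongr; exact min_le_right _ _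
    have h2 : 2 * b * (ϑ / (4 * (b + 1))) ≤ ϑ / 2 := by
      rw [← mul_div_assoc, div_le_div_iff₀ (by positivity) (by norm_num)]
      nlinarith
    linarith
  set C₁ := 1 + C with hC₁
  set D := b * (C₁ + C₁ ^ 2) + ϑ / 3 * C₁ ^ 2 with hD
  have hD0 : 0 ≤ D := by positivity
  obtain ⟨r, hr, hrr, hrD⟩ : ∃ r > 0, r < r₀ ∧ r * D ≤ ϑ := by
    refine ⟨min (r₀ / 2) (ϑ / (D + 1)), by positivity,
      (min_le_left _ _).trans_lt (by linarith), ?_⟩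
    have h1 : min (r₀ / 2) (ϑ / (D + 1)) * D ≤ ϑ / (D + 1) * D := by
      gcongr; exact min_le_right _ _
    have h2 : ϑ / (D + 1) * D ≤ ϑ := by
      rw [div_mul_eq_mul_div, div_le_iff₀ (by positivity)]
      nlinarith
    linarith
  refine ⟨κ, hκ, r, hr, fun s d hs hd hy => ?_⟩
  have h1 := htay (s, d) (by
    rw [mem_ball_zero_iff, Prod.norm_mk, max_lt_iff, Real.norm_eq_abs]
    exact ⟨by linarith, by linarith⟩)
  set z := ⟪ℓ, d⟫ with hz
  set y := d - z • ℓ with hyd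
  have hzr : |z| ≤ r := (abs_inner_le_norm_of_unit hℓ d).trans hd
  have hlin : fderiv ℝ φ (τ, ξ) (s, d) = fderiv ℝ φ (τ, ξ) (1, 0) * s := by
    have : ((s, d) : ℝ × E) = s • ((1 : ℝ), (0 : E)) + (0, d) := by simp
    rw [this, map_add, hφx, map_smul, smul_eq_mul, add_zero, mul_comm]
  have hv : ((s, d) : ℝ × E) = z • ((0 : ℝ), ℓ) + (s, y) := by simp [hyd]
  have hN : ‖((s, y) : ℝ × E)‖ ≤ |s| + ‖y‖ := by
    rw [Prod.norm_mk, Real.norm_eq_abs]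
    exact max_le (by linarith [norm_nonneg y]) (by linarith [abs_nonneg s])
  set N := |s| + ‖y‖ with hNdef
  have hN0 : 0 ≤ N := by positivity
  have hℓn : ‖((0 : ℝ), ℓ)‖ = 1 := by simp [Prod.norm_mk, hℓ]
  have hquad : |B (s, d) (s, d) - B (0, ℓ) (0, ℓ) * z ^ 2| ≤ b * (2 * (|z| * N) + N ^ 2) := by
    rw [hv]
    simp only [map_add, map_smul, add_apply, smul_apply, smul_eq_mul]
    have e1 : |B (0, ℓ) (s, y)| ≤ b * N := by
      refine (hbB _ _).trans ?_
      rw [hℓn, mul_one]; gcongr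
    have e2 : |B (s, y) (0, ℓ)| ≤ b * N := by
      refine (hbB _ _).trans ?_
      rw [hℓn, mul_one]; gcongr
    have e3 : |B (s, y) (s, y)| ≤ b * N ^ 2 := by
      refine (hbB _ _).trans ?_
      rw [pow_two, ← mul_assoc]; gcongr
    have e5 : |z * B (0, ℓ) (s, y)| ≤ |z| * (b * N) := by rw [abs_mul]; gcongr
    have e6 : |z * B (s, y) (0, ℓ)| ≤ |z| * (b * N) := by rw [abs_mul]; gcongr
    have e7 := abs_add_three (z * B (0, ℓ) (s, y)) (z * B (s, y) (0, ℓ)) (B (s, y) (s, y))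
    refine le_trans (le_of_eq ?_) (e7.trans (by linarith : _ ≤ b * (2 * (|z| * N) + N ^ 2)))
    congr 1
    ring
  have hdn : ‖((s, d) : ℝ × E)‖ ≤ |z| + N := by
    rw [hv]
    refine (norm_add_le _ _).trans ?_
    rw [norm_smul, hℓn, mul_one, Real.norm_eq_abs]
    gcongr
  rw [hφ0, hlin, sub_zero] at h1
  have hS0 := abs_nonneg s
  have hz2 : |z| ^ 2 = z ^ 2 := sq_abs z
  have hNle : N ≤ C₁ * |s| + κ * |z| := by rw [hNdef, hC₁]; linarith
  have hsq : ‖((s, d) : ℝ × E)‖ ^ 2 ≤ 2 * |z| ^ 2 + 2 * N ^ 2 := by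
    calc ‖((s, d) : ℝ × E)‖ ^ 2 ≤ (|z| + N) ^ 2 := by gcongr
      _ ≤ 2 * |z| ^ 2 + 2 * N ^ 2 := by linarith [sq_nonneg (|z| - N)]
  have hfin := fold_remainder_le hϑ hb0 hκ.le hκ1 hκb (by positivity) hrD hS0 hs
    (abs_nonneg z) hzr hN0 hNle
  rw [hz2] at hfin
  refine le_trans ?_ hfin
  have h2 : ϑ / 12 * ‖((s, d) : ℝ × E)‖ ^ 2 ≤ ϑ / 12 * (2 * |z| ^ 2 + 2 * N ^ 2) := by gcongr
  rw [hz2] at h2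
  have h3 := abs_le.1 h1
  have h4 := abs_le.1 hquad
  have h5 : φ ((τ, ξ) + (s, d)) = φ (τ + s, ξ + d) := rfl
  rw [h5] at h3
  exact abs_le.2 ⟨by linarith [h3.1, h4.1], by linarith [h3.2, h4.2]⟩

/-- Critical points close to a fold point lie on an approximate parabola. -/
theorem exists_fold_critical {G : ℝ × E → E} {τ : ℝ} {ξ ℓ : E} {A : E →L[ℝ] E}
    (hG : ContDiffAt ℝ 2 G (τ, ξ)) (hG0 : G (τ, ξ) = 0)
    (hA : ∀ v, fderiv ℝ G (τ, ξ) (0, v) = A v) (hℓ : ‖ℓ‖ = 1) (hAℓ : ∀ v, ⟪ℓ, A v⟫ = 0)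
    {lam : ℝ} (hlam : 0 < lam) (hco : ∀ v, lam * (‖v‖ ^ 2 - ⟪ℓ, v⟫ ^ 2) ≤ ⟪v, A v⟫)
    {ϑ : ℝ} (hϑ : 0 < ϑ) :
    ∃ r > 0, ∀ s : ℝ, ∀ d : E, |s| ≤ r → ‖d‖ ≤ r → G (τ + s, ξ + d) = 0 →
      |fderiv ℝ (fun p => ⟪ℓ, G p⟫) (τ, ξ) (1, 0) * s +
        fderiv ℝ (fderiv ℝ fun p => ⟪ℓ, G p⟫) (τ, ξ) (0, ℓ) (0, ℓ) / 2 * ⟪ℓ, d⟫ ^ 2| ≤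
        ϑ * (|s| + ⟪ℓ, d⟫ ^ 2) ∧ (s = 0 → ⟪ℓ, d⟫ = 0 → d = 0) := by
  have hGd : DifferentiableAt ℝ G (τ, ξ) := hG.differentiableAt (by simp)
  have hφ : ContDiffAt ℝ 2 (fun p => ⟪ℓ, G p⟫) (τ, ξ) := contDiffAt_const.inner ℝ hG
  have hφ0 : ⟪ℓ, G (τ, ξ)⟫ = 0 := by rw [hG0, inner_zero_right]
  have hφx : ∀ v, fderiv ℝ (fun p => ⟪ℓ, G p⟫) (τ, ξ) (0, v) = 0 := by
    intro v
    rw [fderiv_inner_apply ℝ (differentiableAt_const ℓ) hGd]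
    simp [hA, hAℓ]
  set B := fderiv ℝ G (τ, ξ) (1, 0) with hBdef
  obtain ⟨κ, hκ, r₁, hr₁, hexp⟩ := exists_fold_expansion hφ hφ0 hφx hℓ
    (C := 2 * ‖B‖ / lam + 1) (by positivity) hϑ
  obtain ⟨k, hk, hk1, hk2⟩ : ∃ k > 0, k ≤ lam / 2 ∧ 2 * k ≤ lam * κ :=
    ⟨min (lam / 2) (lam * κ / 2), by positivity, min_le_left _ _,
      by linarith [min_le_right (lam / 2) (lam * κ / 2)]⟩
  obtain ⟨r₂, hr₂, hlin⟩ := Metric.eventually_nhds_iff_ball.1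
    ((hasFDerivAt_iff_isLittleO_nhds_zero.1 hGd.hasFDerivAt).def hk)
  refine ⟨min r₁ (r₂ / 2), by positivity, fun s d hs hd hcrit => ?_⟩
  have h1 := hlin (s, d) (by
    rw [mem_ball_zero_iff, Prod.norm_mk, max_lt_iff, Real.norm_eq_abs]
    have := min_le_right r₁ (r₂ / 2)
    exact ⟨by linarith, by linarith⟩)
  have h2 : G ((τ, ξ) + (s, d)) = 0 := hcrit
  have h3 : fderiv ℝ G (τ, ξ) (s, d) = s • B + A d := by
    have : ((s, d) : ℝ × E) = s • ((1 : ℝ), (0 : E)) + (0, d) := by simp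
    rw [this, map_add, hA, map_smul]
  rw [h2, hG0, h3, sub_zero, zero_sub, norm_neg] at h1
  set z := ⟪ℓ, d⟫ with hz
  set y := d - z • ℓ with hyd
  have hdn : ‖d‖ ≤ |z| + ‖y‖ := norm_le_abs_add_norm_sub hℓ d
  have hvn : ‖((s, d) : ℝ × E)‖ ≤ |s| + (|z| + ‖y‖) := by
    rw [Prod.norm_mk, Real.norm_eq_abs]
    exact max_le (by linarith [norm_nonneg y, abs_nonneg z]) (by linarith [abs_nonneg s])
  have hyA : ⟪y, A d⟫ = ⟪d, A d⟫ := by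
    rw [hyd, inner_sub_left, inner_smul_left, hAℓ]; simp
  have h4 : lam * ‖y‖ ^ 2 ≤ ⟪y, A d⟫ := by
    rw [hyA, hyd, norm_sub_inner_smul_sq hℓ]
    exact hco d
  have h5 : ⟪y, A d⟫ ≤ ‖y‖ * (k * (|s| + (|z| + ‖y‖)) + |s| * ‖B‖) := by
    have e1 : A d = (s • B + A d) - s • B := by abel
    refine (real_inner_le_norm _ _).trans ?_
    gcongr
    rw [e1]
    refine (norm_sub_le _ _).trans ?_
    rw [norm_smul, Real.norm_eq_abs]
    gcongr
    exact h1.trans (by gcongr)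
  have h6 : lam * ‖y‖ ≤ k * (|s| + (|z| + ‖y‖)) + |s| * ‖B‖ := by
    rcases (norm_nonneg y).eq_or_lt with h | h
    · rw [← h]; rw [mul_zero]; positivity
    · refine le_of_mul_le_mul_left ?_ h
      linarith
  have h7 : ‖y‖ ≤ (2 * ‖B‖ / lam + 1) * |s| + κ * |z| := by
    have e1 : k * ‖y‖ ≤ lam / 2 * ‖y‖ := by gcongr
    have e2 : k * |s| ≤ lam / 2 * |s| := by gcongr
    have e3 : 2 * k * |z| ≤ lam * κ * |z| := by gcongr
    refine le_of_mul_le_mul_left ?_ hlam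
    have e4 : lam * ((2 * ‖B‖ / lam + 1) * |s| + κ * |z|) =
        2 * (‖B‖ * |s|) + lam * |s| + lam * κ * |z| := by field_simp
    rw [e4]
    linarith
  refine ⟨?_, fun hs0 hz0 => ?_⟩
  · have := hexp s d (hs.trans (min_le_left _ _)) (hd.trans (min_le_left _ _)) h7
    simp only [hcrit, inner_zero_right] at this
    rw [← abs_neg]
    refine le_trans (le_of_eq ?_) this
    congr 1
    ring
  · rw [hs0, hz0, abs_zero, mul_zero, mul_zero, add_zero] at h7
    rw [hz0, abs_zero] at hdn
    exact norm_le_zero_iff.1 (by linarith)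

end Fold

section FoldBox

theorem fderiv_uncurry_inr {E F : Type*} [NormedAddCommGroup E] [NormedSpace ℝ E]
    [NormedAddCommGroup F] [NormedSpace ℝ F] {g : ℝ → E → F} {τ : ℝ} {ξ : E}
    (hg : DifferentiableAt ℝ (fun p : ℝ × E => g p.1 p.2) (τ, ξ)) (v : E) :
    fderiv ℝ (fun p : ℝ × E => g p.1 p.2) (τ, ξ) (0, v) = fderiv ℝ (g τ) ξ v := by
  have h1 : HasFDerivAt (g τ) ((fderiv ℝ (fun p : ℝ × E => g p.1 p.2) (τ, ξ)).comp
      (ContinuousLinearMap.inr ℝ ℝ E)) ξ :=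
    HasFDerivAt.comp (g := fun p : ℝ × E => g p.1 p.2) (f := fun x => (τ, x)) ξ
      hg.hasFDerivAt (hasFDerivAt_prodMk_right τ ξ)
  rw [h1.fderiv]
  simp

theorem exists_norm_sub_time_le {E F : Type*} [PseudoMetricSpace E] [NormedAddCommGroup F]
    {T : ℝ} {g : ℝ → E → F} (hg : ContinuousOn (Function.uncurry g) (Icc 0 T ×ˢ univ))
    {τ : ℝ} (hτ : τ ∈ Icc 0 T) {K : Set E} (hK : IsCompact K) {θ : ℝ} (hθ : 0 < θ) :
    ∃ δ > 0, ∀ t ∈ Icc 0 T, |t - τ| ≤ δ → ∀ x ∈ K, ‖g t x - g τ x‖ ≤ θ := by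
  have huc := ((isCompact_Icc (a := (0 : ℝ)) (b := T)).prod hK).uniformContinuousOn_of_continuous
    (hg.mono (prod_mono_right (subset_univ K)))
  obtain ⟨δ, hδ, h⟩ := Metric.uniformContinuousOn_iff.1 huc θ hθ
  refine ⟨δ / 2, by positivity, fun t ht htτ x hx => ?_⟩
  have := h (t, x) ⟨ht, hx⟩ (τ, x) ⟨hτ, hx⟩ (by
    rw [Prod.dist_eq, dist_self, Real.dist_eq, max_lt_iff]
    exact ⟨by linarith, hδ⟩)
  rw [dist_eq_norm] at this
  exact this.le

variable {E : Type*} [NormedAddCommGroup E] [InnerProductSpace ℝ E]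

/-- The cylinder `{ξ + d}` with `‖d - ⟪ℓ, d⟫ ℓ‖ ≤ σ`, `|⟪ℓ, d⟫| ≤ ρ` around a fold point `(τ, ξ)`
of `g`: for times near `τ` the flow of `-g` enters it through its lateral face and its bottom
`⟪ℓ, d⟫ = -ρ`, and there are no zeros of `g t` in it for `t > τ`. -/
structure IsFoldBox (g : ℝ → E → E) (T τ : ℝ) (ξ ℓ : E) (A : E →L[ℝ] E) (lam ρ σ δ : ℝ) :
    Prop where
  norm_eq : ‖ℓ‖ = 1
  lam_pos : 0 < lam
  ρ_pos : 0 < ρ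
  σ_pos : 0 < σ
  δ_pos : 0 < δ
  σ_le : σ ≤ ρ
  window : ∀ t, |t - τ| ≤ δ → t ∈ Icc 0 T
  inner_apply : ∀ v, ⟪ℓ, A v⟫ = 0
  coercive : ∀ v, lam * (‖v‖ ^ 2 - ⟪ℓ, v⟫ ^ 2) ≤ ⟪v, A v⟫
  side : ∀ t, |t - τ| ≤ δ → ∀ d, ‖d‖ ^ 2 - ⟪ℓ, d⟫ ^ 2 = σ ^ 2 → |⟪ℓ, d⟫| ≤ ρ →
    0 < ⟪d - ⟪ℓ, d⟫ • ℓ, g t (ξ + d)⟫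
  bottom : ∀ t, |t - τ| ≤ δ → ∀ d, ‖d‖ ^ 2 - ⟪ℓ, d⟫ ^ 2 ≤ σ ^ 2 → ⟪ℓ, d⟫ = -ρ →
    ⟪ℓ, g t (ξ + d)⟫ < 0
  eq_zero : ∀ t, τ ≤ t → t ≤ τ + δ → ∀ d, ‖d‖ ^ 2 - ⟪ℓ, d⟫ ^ 2 ≤ σ ^ 2 → |⟪ℓ, d⟫| ≤ ρ →
    g t (ξ + d) = 0 → t = τ ∧ d = 0
  linear : ∀ d d', ‖d‖ ^ 2 - ⟪ℓ, d⟫ ^ 2 ≤ σ ^ 2 → |⟪ℓ, d⟫| ≤ ρ →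
    ‖d'‖ ^ 2 - ⟪ℓ, d'⟫ ^ 2 ≤ σ ^ 2 → |⟪ℓ, d'⟫| ≤ ρ →
    ‖g τ (ξ + d) - g τ (ξ + d') - A (d - d')‖ ≤ lam / 24 * ‖d - d'‖

theorem norm_le_of_mem_cylinder {ℓ d : E} {ρ σ : ℝ} (hσ : 0 < σ) (hσρ : σ ≤ ρ)
    (h1 : ‖d‖ ^ 2 - ⟪ℓ, d⟫ ^ 2 ≤ σ ^ 2) (h2 : |⟪ℓ, d⟫| ≤ ρ) : ‖d‖ ≤ 2 * ρ := by
  have h3 : ⟪ℓ, d⟫ ^ 2 ≤ ρ ^ 2 := sq_le_sq' (abs_le.1 h2).1 (abs_le.1 h2).2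
  have h4 : σ ^ 2 ≤ ρ ^ 2 := pow_le_pow_left₀ hσ.le hσρ 2
  refine le_of_sq_le_sq ?_ (by linarith)
  nlinarith

variable [FiniteDimensional ℝ E]

set_option maxHeartbeats 1000000 in
theorem exists_isFoldBox {T : ℝ} (hT : 0 < T) {g : ℝ → E → E}
    (hg : ContDiffOn ℝ 2 (Function.uncurry g) (Icc 0 T ×ˢ univ)) {τ : ℝ} (hτ : τ ∈ Ioo 0 T)
    {ξ ℓ : E} (hξ : g τ ξ = 0) (hℓ : ‖ℓ‖ = 1) {A : E →L[ℝ] E} (hA : fderiv ℝ (g τ) ξ = A)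
    (hAℓ : ∀ v, ⟪ℓ, A v⟫ = 0) {lam : ℝ} (hlam : 0 < lam)
    (hco : ∀ v, lam * (‖v‖ ^ 2 - ⟪ℓ, v⟫ ^ 2) ≤ ⟪v, A v⟫)
    (hα : fderiv ℝ (fun p : ℝ × E => ⟪ℓ, g p.1 p.2⟫) (τ, ξ) (1, 0) < 0)
    (hc : fderiv ℝ (fderiv ℝ fun p : ℝ × E => ⟪ℓ, g p.1 p.2⟫) (τ, ξ) (0, ℓ) (0, ℓ) < 0)
    {r₀ : ℝ} (hr₀ : 0 < r₀) :
    ∃ ρ σ δ, 2 * ρ ≤ r₀ ∧ δ ≤ r₀ ∧ IsFoldBox g T τ ξ ℓ A lam ρ σ δ := by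
  have hτ' : τ ∈ Icc 0 T := Ioo_subset_Icc_self hτ
  have hG : ContDiffAt ℝ 2 (fun p : ℝ × E => g p.1 p.2) (τ, ξ) :=
    (hg (τ, ξ) ⟨hτ', mem_univ _⟩).contDiffAt (interior_prod_mem_nhds hτ ξ)
  have hGd : DifferentiableAt ℝ (fun p : ℝ × E => g p.1 p.2) (τ, ξ) :=
    hG.differentiableAt (by simp)
  have hGA : ∀ v, fderiv ℝ (fun p : ℝ × E => g p.1 p.2) (τ, ξ) (0, v) = A v := fun v => by
    rw [fderiv_uncurry_inr hGd, hA]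
  have hφ : ContDiffAt ℝ 2 (fun p : ℝ × E => ⟪ℓ, g p.1 p.2⟫) (τ, ξ) := contDiffAt_const.inner ℝ hG
  have hφx : ∀ v, fderiv ℝ (fun p : ℝ × E => ⟪ℓ, g p.1 p.2⟫) (τ, ξ) (0, v) = 0 := by
    intro v
    rw [fderiv_inner_apply ℝ (differentiableAt_const ℓ) hGd]
    simp [hGA, hAℓ]
  set α := fderiv ℝ (fun p : ℝ × E => ⟪ℓ, g p.1 p.2⟫) (τ, ξ) (1, 0) with hαdef
  set c := fderiv ℝ (fderiv ℝ fun p : ℝ × E => ⟪ℓ, g p.1 p.2⟫) (τ, ξ) (0, ℓ) (0, ℓ) with hcdef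
  obtain ⟨ϑ, hϑ, hϑα, hϑc⟩ : ∃ ϑ > 0, ϑ < -α ∧ ϑ < -c / 2 :=
    ⟨min (-α / 2) (-c / 4), lt_min (by linarith) (by linarith),
      (min_le_left _ _).trans_lt (by linarith), (min_le_right _ _).trans_lt (by linarith)⟩
  obtain ⟨κ, hκ, r₁, hr₁, hexp⟩ := exists_fold_expansion hφ (by simp [hξ]) hφx hℓ le_rfl hϑ
  obtain ⟨r₂, hr₂, hcrit⟩ := exists_fold_critical hG hξ hGA hℓ hAℓ hlam hco hϑ
  set κ' := min κ 1 with hκ'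
  have hκ'0 : 0 < κ' := by positivity
  set κ₁ := min (lam / 24) (lam * κ' / 8) with hκ₁
  have hκ₁0 : 0 < κ₁ := by positivity
  obtain ⟨r₃, hr₃, hlin⟩ := exists_norm_sub_sub_fderiv_le hT (hg.of_le (by norm_num)) hτ' ξ hκ₁0
  obtain ⟨ρ, hρ, hρ0, hρ1, hρ2, hρ3⟩ : ∃ ρ > 0, 2 * ρ ≤ r₀ ∧ 2 * ρ ≤ r₁ ∧ 2 * ρ ≤ r₂ ∧
      2 * ρ ≤ r₃ := by
    refine ⟨min (min r₀ r₁) (min r₂ r₃) / 2, by positivity, ?_⟩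
    have h1 := min_le_left (min r₀ r₁) (min r₂ r₃)
    have h2 := min_le_right (min r₀ r₁) (min r₂ r₃)
    have h3 := min_le_left r₀ r₁
    have h4 := min_le_right r₀ r₁
    have h5 := min_le_left r₂ r₃
    have h6 := min_le_right r₂ r₃
    refine ⟨?_, ?_, ?_, ?_⟩ <;> linarith
  set σ := κ' * ρ with hσdef
  have hσ : 0 < σ := by positivity
  have hσρ : σ ≤ ρ := by
    rw [hσdef]
    exact mul_le_of_le_one_left hρ.le (min_le_right _ _)
  obtain ⟨θ, hθ, hθ1, hθ2⟩ : ∃ θ > 0, θ ≤ lam * σ / 4 ∧ θ < (-c / 2 - ϑ) * ρ ^ 2 := by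
    have : 0 < (-c / 2 - ϑ) * ρ ^ 2 := mul_pos (by linarith) (by positivity)
    exact ⟨min (lam * σ / 4) ((-c / 2 - ϑ) * ρ ^ 2 / 2), by positivity, min_le_left _ _,
      (min_le_right _ _).trans_lt (by linarith)⟩
  obtain ⟨δ₁, hδ₁, htime⟩ := exists_norm_sub_time_le hg.continuousOn hτ'
    (isCompact_closedBall ξ (2 * ρ)) hθ
  obtain ⟨δ, hδ, hδ1, hδ2, hδ3, hδ4, hδ0⟩ : ∃ δ > 0, δ ≤ δ₁ ∧ δ ≤ r₂ ∧ δ ≤ τ ∧ δ ≤ T - τ ∧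
      δ ≤ r₀ := by
    have h0 : 0 < min τ (T - τ) := lt_min hτ.1 (by linarith [hτ.2])
    refine ⟨min r₀ (min (min δ₁ r₂) (min τ (T - τ))), by positivity, ?_⟩
    have h1 := min_le_left (min δ₁ r₂) (min τ (T - τ))
    have h2 := min_le_right (min δ₁ r₂) (min τ (T - τ))
    have h3 := min_le_left δ₁ r₂
    have h4 := min_le_right δ₁ r₂
    have h5 := min_le_left τ (T - τ)
    have h6 := min_le_right τ (T - τ)
    have h7 := min_le_right r₀ (min (min δ₁ r₂) (min τ (T - τ)))
    have h8 := min_le_left r₀ (min (min δ₁ r₂) (min τ (T - τ)))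
    refine ⟨?_, ?_, ?_, ?_, ?_⟩ <;> linarith
  have hwin : ∀ t, |t - τ| ≤ δ → t ∈ Icc 0 T := fun t ht =>
    ⟨by linarith [(abs_le.1 ht).1], by linarith [(abs_le.1 ht).2]⟩
  have hmem : ∀ d : E, ‖d‖ ^ 2 - ⟪ℓ, d⟫ ^ 2 ≤ σ ^ 2 → |⟪ℓ, d⟫| ≤ ρ → ‖d‖ ≤ 2 * ρ := fun d =>
    norm_le_of_mem_cylinder hσ hσρ
  have hball : ∀ (d : E) (r : ℝ), ‖d‖ ≤ r → ξ + d ∈ Metric.closedBall ξ r := fun d r h => by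
    rwa [mem_closedBall_iff_norm, add_sub_cancel_left]
  have hA' : ∀ d d' : E, ‖d‖ ≤ 2 * ρ → ‖d'‖ ≤ 2 * ρ →
      ‖g τ (ξ + d) - g τ (ξ + d') - A (d - d')‖ ≤ κ₁ * ‖d - d'‖ := by
    intro d d' h h'
    have := hlin τ hτ' (by simpa using hr₃.le) _ (hball d r₃ (h.trans hρ3)) _
      (hball d' r₃ (h'.trans hρ3))
    rwa [add_sub_add_left_eq_sub, hA] at this
  refine ⟨ρ, σ, δ, hρ0, hδ0, hℓ, hlam, hρ, hσ, hδ, hσρ, hwin, hAℓ, hco, ?_, ?_, ?_, ?_⟩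
  · intro t ht d hd hz
    have hdn := hmem d hd.le hz
    have h1 := htime t (hwin t ht) (ht.trans hδ1) _ (hball d _ hdn)
    have h2 := hA' d 0 hdn (by simpa using hρ.le)
    rw [add_zero, hξ, sub_zero, sub_zero] at h2
    set y := d - ⟪ℓ, d⟫ • ℓ with hy
    have hyn : ‖y‖ = σ := by
      have := norm_sub_inner_smul_sq hℓ d
      rw [hd] at this
      exact (pow_left_inj₀ (norm_nonneg _) hσ.le two_ne_zero).1 this
    have h3 : ⟪y, A d⟫ = ⟪d, A d⟫ := by
      rw [hy, inner_sub_left, inner_smul_left, hAℓ]; simp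
    have h4 := hco d
    rw [hd, ← h3] at h4
    have h5 : g t (ξ + d) = (g t (ξ + d) - g τ (ξ + d)) + (g τ (ξ + d) - A d) + A d := by abel
    rw [h5, inner_add_right, inner_add_right]
    have h6 := (abs_le.1 ((abs_real_inner_le_norm y _).trans
      (mul_le_mul_of_nonneg_left h1 (norm_nonneg y)))).1
    have h7 : κ₁ * ‖d‖ ≤ lam * σ / 4 := by
      calc κ₁ * ‖d‖ ≤ lam * κ' / 8 * (2 * ρ) := by
            gcongr
            exact min_le_right _ _
        _ = lam * σ / 4 := by rw [hσdef]; ring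
    have h8 := (abs_le.1 ((abs_real_inner_le_norm y _).trans
      (mul_le_mul_of_nonneg_left (h2.trans h7) (norm_nonneg y)))).1
    rw [hyn] at h6 h8
    have h9 : σ * θ ≤ σ * (lam * σ / 4) := by gcongr
    nlinarith [mul_pos hlam (pow_pos hσ 2)]
  · intro t ht d hd hz
    have hz' : |⟪ℓ, d⟫| = ρ := by rw [hz, abs_neg, abs_of_pos hρ]
    have hdn := hmem d hd hz'.le
    have h1 := htime t (hwin t ht) (ht.trans hδ1) _ (hball d _ hdn)
    have h2 := hexp 0 d (by simpa using hr₁.le) (hdn.trans hρ1) (by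
      rw [hz', zero_mul, zero_add]
      have h3 : ‖d - ⟪ℓ, d⟫ • ℓ‖ ≤ σ :=
        le_of_sq_le_sq (by rw [norm_sub_inner_smul_sq hℓ]; exact hd) hσ.le
      refine h3.trans ?_
      rw [hσdef]
      gcongr
      exact min_le_left _ _)
    rw [add_zero, hz, abs_zero, mul_zero, sub_zero, zero_add] at h2
    have h3 := (abs_le.1 h2).2
    have h4 := (abs_le.1 (abs_inner_le_norm_of_unit hℓ (g t (ξ + d) - g τ (ξ + d)))).2
    rw [inner_sub_right] at h4
    have h5 : (-ρ) ^ 2 = ρ ^ 2 := by ring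
    rw [h5] at h3
    simp only [← hcdef] at h3
    linarith
  · intro t ht ht' d hd hz h0
    have hdn := hmem d hd hz
    have h1 := hcrit (t - τ) d (by rw [abs_of_nonneg (by linarith)]; linarith) (hdn.trans hρ2)
      (by simpa using h0)
    have h2 := (abs_le.1 h1.1).1
    simp only [← hcdef] at h2
    rw [abs_of_nonneg (by linarith : 0 ≤ t - τ)] at h2
    have h3 : 0 ≤ ⟪ℓ, d⟫ ^ 2 := sq_nonneg _
    have h4 : 0 ≤ t - τ := by linarith
    have h5 : t - τ = 0 := by
      nlinarith [mul_nonneg (by linarith : 0 ≤ -α - ϑ) h4,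
        mul_nonneg (by linarith : 0 ≤ -c / 2 - ϑ) h3]
    have h6 : ⟪ℓ, d⟫ ^ 2 = 0 := by
      rw [h5] at h2
      nlinarith
    exact ⟨by linarith, h1.2 h5 (pow_eq_zero_iff two_ne_zero |>.1 h6)⟩
  · intro d d' hd hz hd' hz'
    refine (hA' d d' (hmem d hd hz) (hmem d' hd' hz')).trans ?_
    gcongr
    exact min_le_left _ _

end FoldBox

section FoldPoint

theorem apply_eq_zero_of_inner_eq_zero {E : Type*} [NormedAddCommGroup E]
    [InnerProductSpace ℝ E] {A : E →L[ℝ] E} (hsymm : ∀ v w, ⟪A v, w⟫ = ⟪v, A w⟫)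
    (hpos : ∀ v, 0 ≤ ⟪A v, v⟫) {v : E} (hv : ⟪A v, v⟫ = 0) : A v = 0 := by
  set M := ⟪A (A v), A v⟫ with hM
  set N := ⟪A v, A v⟫ with hN
  have hM0 : 0 ≤ M := hpos _
  have key : ∀ r : ℝ, 0 ≤ 2 * r * N + r ^ 2 * M := by
    intro r
    have h1 := hpos (v + r • A v)
    simp only [map_add, map_smul, inner_add_left, inner_add_right, inner_smul_left,
      inner_smul_right, RCLike.conj_to_real] at h1
    rw [hsymm (A v) v, ← hN, ← hM, hv] at h1
    linarith
  have h2 := key (-(N / (M + 1)))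
  have h3 : 2 * -(N / (M + 1)) * N + (-(N / (M + 1))) ^ 2 * M =
      -(N ^ 2 * (M + 2)) / (M + 1) ^ 2 := by
    field_simp
    ring
  rw [h3, le_div_iff₀ (by positivity), zero_mul] at h2
  have h4 : N ^ 2 = 0 := by nlinarith [sq_nonneg N]
  exact inner_self_eq_zero.1 (pow_eq_zero_iff two_ne_zero |>.1 h4)

variable {n : ℕ} {T : ℝ} {f : ℝ → EuclideanSpace ℝ (Fin n) → ℝ}

theorem thirdDeriv_smul (t : ℝ) (x ℓ : EuclideanSpace ℝ (Fin n)) (r : ℝ) :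
    thirdDeriv f t x (r • ℓ) = r ^ 3 * thirdDeriv f t x ℓ := by
  have h : ![r • ℓ, r • ℓ, r • ℓ] = fun i => (fun _ : Fin 3 => r) i • ![ℓ, ℓ, ℓ] i := by
    ext i
    fin_cases i <;> rfl
  rw [thirdDeriv, h, ContinuousMultilinearMap.map_smul_univ]
  simp [thirdDeriv]

/-- Every transversal degenerate critical point at the end of a branch of critical points has
arbitrarily small fold boxes. -/
theorem exists_isFoldBox_of_transversal (hT : 0 < T)
    (hf : ContDiffOn ℝ 3 (Function.uncurry f) (Icc 0 T ×ˢ univ)) {τ : ℝ} (hτ : τ ∈ Ioo 0 T)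
    {ξ : EuclideanSpace ℝ (Fin n)} (hξ : gradient (f τ) ξ = 0) (hpsd : HessPosSemidef f τ ξ)
    {ℓ₀ : EuclideanSpace ℝ (Fin n)} (hℓ₀ : ℓ₀ ≠ 0)
    (hker : LinearMap.ker (fderiv ℝ (gradient (f τ)) ξ).toLinearMap = Submodule.span ℝ {ℓ₀})
    (hft : ⟪gradft f τ ξ, ℓ₀⟫ ≠ 0) (hthird : thirdDeriv f τ ξ ℓ₀ ≠ 0)
    {U : ℝ → EuclideanSpace ℝ (Fin n)} (hU : Tendsto U (𝓝[<] τ) (𝓝 ξ))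
    (hcrit : ∀ᶠ s in 𝓝[<] τ, gradient (f s) (U s) = 0) :
    ∃ ℓ A lam, ∀ r₀ > 0, ∃ ρ σ δ, 2 * ρ ≤ r₀ ∧ δ ≤ r₀ ∧
      IsFoldBox (fun s x => gradient (f s) x) T τ ξ ℓ A lam ρ σ δ := by
  have hτ' : τ ∈ Icc 0 T := Ioo_subset_Icc_self hτ
  have hg := contDiffOn_gradient hT hf
  obtain ⟨r, hr0, hr, hr3⟩ : ∃ r : ℝ, r ≠ 0 ∧ ‖r • ℓ₀‖ = 1 ∧ thirdDeriv f τ ξ (r • ℓ₀) < 0 := by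
    have hn : ‖ℓ₀‖ ≠ 0 := norm_ne_zero_iff.2 hℓ₀
    have hnp : 0 < ‖ℓ₀‖⁻¹ := by positivity
    rcases hthird.lt_or_gt with h | h
    · refine ⟨‖ℓ₀‖⁻¹, hnp.ne', by simp [norm_smul, hn], ?_⟩
      rw [thirdDeriv_smul]
      exact mul_neg_of_pos_of_neg (by positivity) h
    · refine ⟨-‖ℓ₀‖⁻¹, neg_ne_zero.2 hnp.ne', by simp [norm_smul, hn], ?_⟩
      rw [thirdDeriv_smul]
      refine mul_neg_of_neg_of_pos ?_ h
      have : (-‖ℓ₀‖⁻¹) ^ 3 = -(‖ℓ₀‖⁻¹ ^ 3) := by ring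
      rw [this]
      exact neg_neg_of_pos (by positivity)
  set ℓ := r • ℓ₀ with hℓ
  set A := fderiv ℝ (gradient (f τ)) ξ with hA
  have hsymm : ∀ v w, ⟪A v, w⟫ = ⟪v, A w⟫ :=
    inner_fderiv_gradient_comm ((contDiff_slice hf hτ').of_le (by norm_num)) ξ
  have hAℓ0 : A ℓ = 0 := by
    have : ℓ ∈ LinearMap.ker A.toLinearMap := by
      rw [hker, hℓ]
      exact Submodule.smul_mem _ _ (Submodule.mem_span_singleton_self _)
    exact this
  have hAℓ : ∀ v, ⟪ℓ, A v⟫ = 0 := fun v => by rw [← hsymm, hAℓ0, inner_zero_left]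
  have hspan : Submodule.span ℝ {ℓ} = Submodule.span ℝ {ℓ₀} :=
    Submodule.span_singleton_smul_eq hr0.isUnit ℓ₀
  obtain ⟨lam, hlam, hlamW⟩ := exists_coercive_of_pos A (Submodule.span ℝ {ℓ})ᗮ (by
    intro v hv hv0
    rw [real_inner_comm]
    refine (hpsd v).lt_of_ne' fun h => hv0 ?_
    have h1 : v ∈ Submodule.span ℝ {ℓ} := by
      rw [hspan, ← hker]
      exact apply_eq_zero_of_inner_eq_zero hsymm hpsd h
    exact (Submodule.mem_bot ℝ).1 ((Submodule.inf_orthogonal_eq_bot _).le ⟨h1, hv⟩))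
  have hco : ∀ v, lam * (‖v‖ ^ 2 - ⟪ℓ, v⟫ ^ 2) ≤ ⟪v, A v⟫ := by
    intro v
    have h1 := hlamW (v - ⟪ℓ, v⟫ • ℓ) (by
      rw [Submodule.mem_orthogonal_singleton_iff_inner_right, inner_sub_right, inner_smul_right,
        real_inner_self_eq_norm_sq, hr]
      ring)
    rw [norm_sub_inner_smul_sq hr, map_sub, map_smul, hAℓ0, smul_zero, sub_zero, inner_sub_left,
      inner_smul_left ℓ, hAℓ] at h1
    simpa using h1
  set c := fderiv ℝ (fderiv ℝ fun p : ℝ × EuclideanSpace ℝ (Fin n) =>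
    ⟪ℓ, gradient (f p.1) p.2⟫) (τ, ξ) (0, ℓ) (0, ℓ) with hcdef
  have hc : c < 0 := by
    rw [hcdef, fderiv_fderiv_inner_gradient hT hf hτ]
    exact hr3
  set α := fderiv ℝ (fun p : ℝ × EuclideanSpace ℝ (Fin n) =>
    ⟪ℓ, gradient (f p.1) p.2⟫) (τ, ξ) (1, 0) with hαdef
  have hα0 : α ≠ 0 := by
    rw [hαdef, fderiv_inner_gradient_time hf hτ, hℓ, inner_smul_right]
    exact mul_ne_zero hr0 hft
  have hα : α < 0 := by
    by_contra hα
    have hα1 : 0 < α := lt_of_le_of_ne (not_lt.1 hα) hα0.symm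
    have hG : ContDiffAt ℝ 2 (fun p : ℝ × EuclideanSpace ℝ (Fin n) => gradient (f p.1) p.2)
        (τ, ξ) := (hg (τ, ξ) ⟨hτ', mem_univ _⟩).contDiffAt (interior_prod_mem_nhds hτ ξ)
    obtain ⟨ϑ, hϑ, hϑα, hϑc⟩ : ∃ ϑ > 0, ϑ < α ∧ ϑ < -c / 2 :=
      ⟨min (α / 2) (-c / 4), lt_min (by linarith) (by linarith),
        (min_le_left _ _).trans_lt (by linarith), (min_le_right _ _).trans_lt (by linarith)⟩
    obtain ⟨R, hR, hfold⟩ := exists_fold_critical hG hξ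
      (fderiv_uncurry_inr (g := fun s x => gradient (f s) x) (hG.differentiableAt (by simp)))
      hr hAℓ hlam hco hϑ
    have hev : ∀ᶠ s in 𝓝[<] τ, gradient (f s) (U s) = 0 ∧ ‖U s - ξ‖ ≤ R ∧ τ - R < s ∧ s < τ := by
      have h1 : ∀ᶠ s in 𝓝[<] τ, U s ∈ Metric.closedBall ξ R :=
        hU.eventually (Metric.closedBall_mem_nhds ξ hR)
      have h2 : ∀ᶠ s in 𝓝[<] τ, τ - R < s :=
        nhdsWithin_le_nhds (lt_mem_nhds (by linarith))
      filter_upwards [hcrit, h1, h2, self_mem_nhdsWithin] with s e1 e2 e3 e4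
      exact ⟨e1, by rwa [← mem_closedBall_iff_norm], e3, e4⟩
    obtain ⟨s, e1, e2, e3, e4⟩ := hev.exists
    have h3 := (hfold (s - τ) (U s - ξ) (abs_le.2 ⟨by linarith, by linarith⟩) e2
      (by simpa using e1)).1
    have h4 := (abs_le.1 h3).1
    simp only [← hcdef, ← hαdef] at h4
    rw [abs_of_neg (by linarith : s - τ < 0)] at h4
    have h5 := mul_nonneg (by linarith : 0 ≤ -c / 2 - ϑ) (sq_nonneg ⟪ℓ, U s - ξ⟫)
    have h6 := mul_pos (by linarith : 0 < α - ϑ) (by linarith : 0 < τ - s)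
    linarith
  exact ⟨ℓ, A, lam, fun r₀ hr₀ => exists_isFoldBox hT hg hτ hξ hr rfl hAℓ hlam hco hα hc hr₀⟩

end FoldPoint

section FoldFlow

variable {E : Type*} [NormedAddCommGroup E] [InnerProductSpace ℝ E]

/-- The cylinder of a fold box. -/
def foldCylinder (ξ ℓ : E) (ρ σ : ℝ) : Set E :=
  {x | ‖x - ξ‖ ^ 2 - ⟪ℓ, x - ξ⟫ ^ 2 ≤ σ ^ 2 ∧ |⟪ℓ, x - ξ⟫| ≤ ρ}

theorem isClosed_foldCylinder (ξ ℓ : E) (ρ σ : ℝ) : IsClosed (foldCylinder ξ ℓ ρ σ) := by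
  have h1 : IsClosed {x : E | ‖x - ξ‖ ^ 2 - ⟪ℓ, x - ξ⟫ ^ 2 ≤ σ ^ 2} :=
    isClosed_le (by fun_prop) (by fun_prop)
  have h2 : IsClosed {x : E | |⟪ℓ, x - ξ⟫| ≤ ρ} := isClosed_le (by fun_prop) (by fun_prop)
  exact h1.inter h2

theorem foldCylinder_subset_closedBall {ξ ℓ : E} {ρ σ : ℝ} (hσ : 0 < σ) (hσρ : σ ≤ ρ) :
    foldCylinder ξ ℓ ρ σ ⊆ Metric.closedBall ξ (2 * ρ) := fun x hx => by
  rw [mem_closedBall_iff_norm]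
  exact norm_le_of_mem_cylinder hσ hσρ hx.1 hx.2

theorem isCompact_foldCylinder [FiniteDimensional ℝ E] {ξ ℓ : E} {ρ σ : ℝ} (hσ : 0 < σ)
    (hσρ : σ ≤ ρ) : IsCompact (foldCylinder ξ ℓ ρ σ) :=
  (isCompact_closedBall ξ (2 * ρ)).of_isClosed_subset (isClosed_foldCylinder ξ ℓ ρ σ)
    (foldCylinder_subset_closedBall hσ hσρ)

theorem foldCylinder_mem_nhds {ξ ℓ : E} {ρ σ : ℝ} (hσ : 0 < σ) (hρ : 0 < ρ) :
    {x ∈ foldCylinder ξ ℓ ρ σ | ⟪ℓ, x - ξ⟫ < ρ} ∈ 𝓝 ξ := by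
  have h1 : ∀ᶠ x in 𝓝 ξ, ‖x - ξ‖ ^ 2 - ⟪ℓ, x - ξ⟫ ^ 2 < σ ^ 2 := by
    have hc : Continuous fun x => ‖x - ξ‖ ^ 2 - ⟪ℓ, x - ξ⟫ ^ 2 := by fun_prop
    refine hc.continuousAt.eventually_lt continuousAt_const ?_
    simpa using pow_pos hσ 2
  have h2 : ∀ᶠ x in 𝓝 ξ, |⟪ℓ, x - ξ⟫| < ρ := by
    have hc : Continuous fun x => |⟪ℓ, x - ξ⟫| := by fun_prop
    refine hc.continuousAt.eventually_lt continuousAt_const ?_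
    simpa using hρ
  filter_upwards [h1, h2] with x e1 e2
  exact ⟨⟨e1.le, e2.le⟩, (le_abs_self _).trans_lt e2⟩

variable {g : ℝ → E → E} {T τ : ℝ} {ξ ℓ : E} {A : E →L[ℝ] E} {lam ρ σ δ : ℝ}

theorem IsFoldBox.mem_foldCylinder (hbox : IsFoldBox g T τ ξ ℓ A lam ρ σ δ) {w : ℝ → E}
    {Θ : ℝ → ℝ} {a b c : ℝ} (hc : 0 < c) (hw : ContinuousOn w (Icc a b))
    (hw' : ∀ s ∈ Ico a b, HasDerivWithinAt w (-(c • g (Θ s) (w s))) (Ici s) s)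
    (hΘ : ∀ s ∈ Ico a b, |Θ s - τ| ≤ δ) (hwa : w a ∈ foldCylinder ξ ℓ ρ σ)
    (hz : ∀ s ∈ Icc a b, ⟪ℓ, w s - ξ⟫ ≤ ρ) : ∀ s ∈ Icc a b, w s ∈ foldCylinder ξ ℓ ρ σ := by
  have hd : ContinuousOn (fun s => w s - ξ) (Icc a b) := hw.sub continuousOn_const
  have hzc : ContinuousOn (fun s => ⟪ℓ, w s - ξ⟫) (Icc a b) := continuousOn_const.inner hd
  have hz' : ∀ s ∈ Ico a b, HasDerivWithinAt (fun s => ⟪ℓ, w s - ξ⟫)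
      ⟪ℓ, -(c • g (Θ s) (w s))⟫ (Ici s) s := fun s hs => by
    simpa using (hasDerivWithinAt_const s (Ici s) ℓ).inner ℝ ((hw' s hs).sub_const ξ)
  have key := le_and_le_of_deriv_neg_at_boundary (P := σ ^ 2) (Q := ρ)
    ((hd.norm.pow 2).sub (hzc.pow 2)) hzc.neg
    (fun s hs => (((hw' s hs).sub_const ξ).norm_sq).sub ((hz' s hs).pow 2))
    (fun s hs => (hz' s hs).neg) hwa.1 (by
      have := (abs_le.1 hwa.2).1
      simp only [Pi.neg_apply]
      linarith) ?_ ?_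
  · intro s hs
    obtain ⟨h1, h2⟩ := key s hs
    simp only [Pi.neg_apply] at h2
    exact ⟨h1, abs_le.2 ⟨by linarith, hz s hs⟩⟩
  · intro s hs h1 h2
    simp only [Pi.neg_apply] at h2
    have h3 := hbox.side (Θ s) (hΘ s hs) (w s - ξ) h1
      (abs_le.2 ⟨by linarith, hz s (Ico_subset_Icc_self hs)⟩)
    rw [add_sub_cancel, inner_sub_left, inner_smul_left] at h3
    simp only [RCLike.conj_to_real] at h3
    have h4 := mul_pos hc h3
    simp only [inner_neg_right, inner_smul_right]
    push_cast
    linarith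
  · intro s hs h1 h2
    simp only [Pi.neg_apply] at h1
    have h3 := hbox.bottom (Θ s) (hΘ s hs) (w s - ξ) h2 (by linarith)
    rw [add_sub_cancel] at h3
    have h4 := mul_pos hc (neg_pos.2 h3)
    rw [inner_neg_right, inner_smul_right]
    linarith

/-- An orbit leaving `ξ` and ending at another critical point crosses the top of the box. -/
theorem IsFoldBox.exists_crossing (hbox : IsFoldBox g T τ ξ ℓ A lam ρ σ δ) {v : ℝ → E} {y : E}
    (hv : ∀ s, HasDerivAt v (-(g τ (v s))) s) (hbot : Tendsto v atBot (𝓝 ξ))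
    (htop : Tendsto v atTop (𝓝 y)) (hy : g τ y = 0) (hyξ : y ≠ ξ) :
    ∃ s₁, ⟪ℓ, v s₁ - ξ⟫ = ρ ∧ ∀ s ≤ s₁, v s ∈ foldCylinder ξ ℓ ρ σ := by
  obtain ⟨s₀, hs₀⟩ := eventually_atBot.1
    (hbot.eventually (foldCylinder_mem_nhds (ℓ := ℓ) hbox.σ_pos hbox.ρ_pos))
  have hvc : Continuous v := continuous_iff_continuousAt.2 fun s => (hv s).continuousAt
  have hinv : ∀ b, (∀ s ∈ Icc s₀ b, ⟪ℓ, v s - ξ⟫ ≤ ρ) →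
      ∀ s ∈ Icc s₀ b, v s ∈ foldCylinder ξ ℓ ρ σ := fun b =>
    hbox.mem_foldCylinder (Θ := fun _ => τ) one_pos hvc.continuousOn
      (fun s _ => by simpa using (hv s).hasDerivWithinAt)
      (fun s _ => by simpa using hbox.δ_pos.le) (hs₀ s₀ le_rfl).1
  obtain ⟨S, hS0, hS⟩ : ∃ S, s₀ ≤ S ∧ ρ ≤ ⟪ℓ, v S - ξ⟫ := by
    by_contra! hlt
    have h1 : ∀ᶠ s in atTop, v s ∈ foldCylinder ξ ℓ ρ σ := by
      filter_upwards [eventually_ge_atTop s₀] with s hs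
      exact hinv s (fun r hr => (hlt r hr.1).le) s ⟨hs, le_rfl⟩
    have h2 : y ∈ foldCylinder ξ ℓ ρ σ := (isClosed_foldCylinder ξ ℓ ρ σ).mem_of_tendsto htop h1
    have h3 := hbox.eq_zero τ le_rfl (by linarith [hbox.δ_pos]) (y - ξ) h2.1 h2.2
      (by rwa [add_sub_cancel])
    exact hyξ (sub_eq_zero.1 h3.2)
  rcases forall_lt_or_exists_first_hit (q := fun s => ⟪ℓ, v s - ξ⟫) (a := s₀) (b := S) (c := ρ)
    (by fun_prop) (hs₀ s₀ le_rfl).2 with h | ⟨s₁, hs₁, heq, hlt⟩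
  · exact absurd (h S ⟨hS0, le_rfl⟩) (not_lt.2 hS)
  · refine ⟨s₁, heq, fun s hs => ?_⟩
    rcases le_total s s₀ with h | h
    · exact (hs₀ s h).1
    · refine hinv s₁ (fun r hr => ?_) s ⟨h, hs⟩
      rcases hr.2.lt_or_eq with h' | h'
      · exact (hlt r ⟨hr.1, h'⟩).le
      · rw [h']; exact heq.le

variable [FiniteDimensional ℝ E]

/-- A perturbed orbit that has spent a long time in the box is close to the heteroclinic orbit
when it leaves. -/
theorem IsFoldBox.exists_norm_sub_lt_at_exit (hbox : IsFoldBox g T τ ξ ℓ A lam ρ σ δ)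
    (hg : ContinuousOn (Function.uncurry g) (Icc 0 T ×ˢ univ)) {v : ℝ → E} {s₁ : ℝ}
    (hv : ∀ s, HasDerivAt v (-(g τ (v s))) s) (hs₁ : ⟪ℓ, v s₁ - ξ⟫ = ρ)
    (hpast : ∀ s ≤ s₁, v s ∈ foldCylinder ξ ℓ ρ σ) {μ : ℝ} (hμ : 0 < μ) :
    ∃ S ≥ 0, ∃ δ₁ > 0, ∀ (W : ℝ → E) (Θ : ℝ → ℝ),
      (∀ s ∈ Icc (-S) 0, HasDerivAt W (-(g (Θ s) (W s))) s) →
      (∀ s ∈ Icc (-S) 0, |Θ s - τ| ≤ δ₁) → (∀ s ∈ Icc (-S) 0, W s ∈ foldCylinder ξ ℓ ρ σ) →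
      ⟪ℓ, W 0 - ξ⟫ = ρ → ‖W 0 - v s₁‖ < μ := by
  have hlam := hbox.lam_pos
  have hτ := hbox.window τ (by simpa using hbox.δ_pos.le)
  obtain ⟨δ₁, hδ₁, htime⟩ := exists_norm_sub_time_le hg hτ
    (isCompact_foldCylinder (ξ := ξ) (ℓ := ℓ) hbox.σ_pos hbox.σ_le)
    (θ := lam * μ / 36) (by positivity)
  have hS : 0 ≤ 2 * (4 * ρ) ^ 2 / (lam * μ ^ 2) + 1 := by positivity
  refine ⟨2 * (4 * ρ) ^ 2 / (lam * μ ^ 2) + 1, hS, min δ₁ δ, lt_min hδ₁ hbox.δ_pos, ?_⟩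
  intro W Θ hW hΘ hWc hW0
  have hmem : ∀ s ∈ Icc (-(2 * (4 * ρ) ^ 2 / (lam * μ ^ 2) + 1)) 0,
      v (s + s₁) ∈ foldCylinder ξ ℓ ρ σ := fun s hs => hpast _ (by linarith [hs.2])
  have hle : ∀ x ∈ foldCylinder ξ ℓ ρ σ, ‖x - ξ‖ ≤ 2 * ρ := fun x hx =>
    norm_le_of_mem_cylinder hbox.σ_pos hbox.σ_le hx.1 hx.2
  have key := norm_lt_of_bounded_past (d := fun s => W s - v (s + s₁))
    (d' := fun s => -(g (Θ s) (W s)) - -(g τ (v (s + s₁)))) (A := A) (ℓ := ℓ) (lam := lam)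
    (κ := lam / 24) (θ := lam * μ / 36) (M := 4 * ρ) (μ := μ) hbox.norm_eq hlam hμ hS
    hbox.coercive hbox.inner_apply ?_ ?_ le_rfl (by linarith) ?_ ?_ ?_
  · simpa using key
  · intro s hs
    exact (hW s hs).sub ((hv (s + s₁)).comp_add_const s s₁)
  · intro s hs
    have h1 := htime (Θ s) (hbox.window _ ((hΘ s hs).trans (min_le_right _ _)))
      ((hΘ s hs).trans (min_le_left _ _)) (W s) (hWc s hs)
    have h2 := hbox.linear (W s - ξ) (v (s + s₁) - ξ) (hWc s hs).1 (hWc s hs).2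
      (hmem s hs).1 (hmem s hs).2
    rw [add_sub_cancel, add_sub_cancel, sub_sub_sub_cancel_right] at h2
    have h3 : -(g (Θ s) (W s)) - -(g τ (v (s + s₁))) + A (W s - v (s + s₁)) =
        -((g τ (W s) - g τ (v (s + s₁)) - A (W s - v (s + s₁))) +
          (g (Θ s) (W s) - g τ (W s))) := by abel
    rw [h3, norm_neg]
    exact (norm_add_le _ _).trans (add_le_add h2 h1)
  · simp only [zero_add]
    rw [← sub_sub_sub_cancel_right _ _ ξ, inner_sub_right, hW0, hs₁, sub_self]
  · intro s hs
    rw [← sub_sub_sub_cancel_right _ _ ξ]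
    refine (norm_sub_le _ _).trans ?_
    linarith [hle _ (hWc s hs), hle _ (hmem s hs)]
  · have : lam * μ ^ 2 * (2 * (4 * ρ) ^ 2 / (lam * μ ^ 2) + 1) / 2 =
        (4 * ρ) ^ 2 + lam * μ ^ 2 / 2 := by field_simp
    rw [this]
    have : 0 < lam * μ ^ 2 := by positivity
    linarith

/-- Continuous dependence on a bounded time interval. -/
theorem exists_norm_sub_le_forward
    (hg : ContDiffOn ℝ 1 (Function.uncurry g) (Icc 0 T ×ˢ univ)) (hτ : τ ∈ Icc 0 T) {v : ℝ → E}
    (hv : ∀ s, HasDerivAt v (-(g τ (v s))) s) (s₁ S : ℝ) {μ : ℝ} (hμ : 0 < μ) :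
    ∃ μ₀ > 0, ∃ δ₁ > 0, ∀ (W : ℝ → E) (Θ : ℝ → ℝ),
      (∀ s ∈ Icc 0 S, HasDerivAt W (-(g (Θ s) (W s))) s) →
      (∀ s ∈ Icc 0 S, Θ s ∈ Icc 0 T ∧ |Θ s - τ| ≤ δ₁) → ‖W 0 - v s₁‖ ≤ μ₀ →
      ∀ s ∈ Icc 0 S, ‖W s - v (s + s₁)‖ ≤ μ := by
  rcases lt_or_ge S 0 with hS | hS
  · exact ⟨1, one_pos, 1, one_pos, fun W Θ _ _ _ s hs => by linarith [hs.1, hs.2]⟩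
  have hvc : Continuous v := continuous_iff_continuousAt.2 fun s => (hv s).continuousAt
  obtain ⟨R, hR⟩ := (isCompact_Icc (a := (0 : ℝ)) (b := S)).exists_bound_of_continuousOn
    (f := fun s => v (s + s₁)) (by fun_prop)
  have hgτ : ContDiff ℝ 1 (g τ) := contDiff_slice hg hτ
  obtain ⟨L, hL⟩ := (isCompact_closedBall (0 : E) (R + 1)).exists_bound_of_continuousOn
    (f := fderiv ℝ (g τ)) (hgτ.continuous_fderiv (by simp)).continuousOn
  have hR0 : 0 ≤ R := (norm_nonneg _).trans (hR 0 ⟨le_rfl, hS⟩)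
  have hL0 : 0 ≤ L := (norm_nonneg _).trans (hL 0 (Metric.mem_closedBall_self (by linarith)))
  have hr : 0 < min μ 1 := by positivity
  set μ₀ := min μ 1 * Real.exp (-((L + 2) * S)) with hμ₀def
  have hμ₀ : 0 < μ₀ := by positivity
  have hμ₀r : μ₀ * Real.exp ((L + 2) * S) = min μ 1 := by
    rw [hμ₀def, mul_assoc, ← Real.exp_add, neg_add_cancel, Real.exp_zero, mul_one]
  obtain ⟨δ₁, hδ₁, htime⟩ := exists_norm_sub_time_le hg.continuousOn hτ
    (isCompact_closedBall (0 : E) (R + 1)) hμ₀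
  refine ⟨μ₀, hμ₀, δ₁, hδ₁, fun W Θ hW hΘ hW0 s hs => ?_⟩
  have key := norm_le_mul_exp_of_deriv_le (d := fun s => W s - v (s + s₁))
    (d' := fun s => -(g (Θ s) (W s)) - -(g τ (v (s + s₁)))) (L := L) (θ := μ₀) (μ := μ₀)
    (r := min μ 1) (S := S)
    (fun s hs => (hW s hs).sub ((hv (s + s₁)).comp_add_const s s₁)) hL0 hμ₀ le_rfl ?_
    (by simpa using hW0) hμ₀r.le s hs
  · refine key.trans ?_
    have : μ₀ * Real.exp ((L + 2) * s) ≤ μ₀ * Real.exp ((L + 2) * S) := by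
      gcongr
      exact hs.2
    linarith [min_le_left μ 1]
  · intro r hr hdr
    have hvr : v (r + s₁) ∈ Metric.closedBall (0 : E) (R + 1) := by
      rw [mem_closedBall_zero_iff]
      linarith [hR r hr]
    have hWr : W r ∈ Metric.closedBall (0 : E) (R + 1) := by
      rw [mem_closedBall_zero_iff]
      have h1 := norm_le_norm_add_norm_sub' (W r) (v (r + s₁))
      linarith [hR r hr, min_le_right μ 1]
    have h1 := htime (Θ r) (hΘ r hr).1 (hΘ r hr).2 (W r) hWr
    have h2 := (convex_closedBall (0 : E) (R + 1)).norm_image_sub_le_of_norm_fderiv_le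
      (𝕜 := ℝ) (f := g τ) (fun x _ => hgτ.differentiable (by simp) x) hL hvr hWr
    have h3 : -(g (Θ r) (W r)) - -(g τ (v (r + s₁))) =
        -((g τ (W r) - g τ (v (r + s₁))) + (g (Θ r) (W r) - g τ (W r))) := by abel
    simp only [h3, norm_neg]
    exact (norm_add_le _ _).trans (add_le_add h2 h1)

end FoldFlow

section Escape

variable {E : Type*} [NormedAddCommGroup E] [InnerProductSpace ℝ E] [CompleteSpace E]

theorem IsSlowFlow.hasDerivWithinAt_energy {f : ℝ → E → ℝ} {ε a b s : ℝ} {w : ℝ → E}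
    (hw : IsSlowFlow (fun s x => gradient (f s) x) ε a b w) (hs : s ∈ Ico a b)
    (hf : DifferentiableAt ℝ (fun p : ℝ × E => f p.1 p.2) (s, w s)) :
    HasDerivWithinAt (fun s => f s (w s)) (fderiv ℝ (fun p : ℝ × E => f p.1 p.2) (s, w s) (1, 0) -
      ‖gradient (f s) (w s)‖ ^ 2 / ε) (Ici s) s := by
  have h1 := hf.hasFDerivAt.comp_hasDerivWithinAt (f := fun s => (s, w s)) s
    ((hasDerivWithinAt_id s (Ici s)).prodMk (hw.2 s hs))
  refine h1.congr_deriv ?_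
  have h2 : (((1 : ℝ), -(ε⁻¹ • gradient (f s) (w s))) : ℝ × E) =
      (1, 0) + (0, -(ε⁻¹ • gradient (f s) (w s))) := by simp
  rw [h2, map_add, fderiv_uncurry_inr hf, ← inner_gradient_eq_fderiv, inner_neg_right,
    inner_smul_right, real_inner_self_eq_norm_sq]
  ring

/-- A gradient flow with large speed leaves every compact set without critical points. -/
theorem exists_not_forall_mem {T : ℝ} (hT : 0 < T) {f : ℝ → E → ℝ}
    (hf : ContDiffOn ℝ 3 (Function.uncurry f) (Icc 0 T ×ˢ univ)) {a b : ℝ} (ha : 0 < a)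
    (hab : a < b) (hb : b < T) {K : Set E} (hK : IsCompact K)
    (hne : ∀ s ∈ Icc a b, ∀ x ∈ K, gradient (f s) x ≠ 0) :
    ∃ ε₀ > 0, ∀ ε, 0 < ε → ε < ε₀ → ∀ w, IsSlowFlow (fun s x => gradient (f s) x) ε a b w →
      ¬ ∀ s ∈ Icc a b, w s ∈ K := by
  have hIK : IsCompact (Icc a b ×ˢ K) := isCompact_Icc.prod hK
  have hopen : IsOpen (Ioo 0 T ×ˢ (univ : Set E)) := isOpen_Ioo.prod isOpen_univ
  have hsub : Icc a b ×ˢ K ⊆ Ioo 0 T ×ˢ univ := fun p hp =>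
    ⟨⟨ha.trans_le hp.1.1, hp.1.2.trans_lt hb⟩, mem_univ _⟩
  have hF : ContDiffOn ℝ 3 (fun p : ℝ × E => f p.1 p.2) (Ioo 0 T ×ˢ univ) :=
    hf.mono (prod_mono_left Ioo_subset_Icc_self)
  have hFd : ∀ p ∈ Icc a b ×ˢ K, DifferentiableAt ℝ (fun p : ℝ × E => f p.1 p.2) p := fun p hp =>
    (hF.differentiableOn (by norm_num) p (hsub hp)).differentiableAt (hopen.mem_nhds (hsub hp))
  obtain ⟨C₀, hC₀⟩ := hIK.exists_bound_of_continuousOn (hF.continuousOn.mono hsub)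
  obtain ⟨C, hC⟩ := hIK.exists_bound_of_continuousOn
    (f := fun p => fderiv ℝ (fun p : ℝ × E => f p.1 p.2) p (1, 0))
    (((hF.continuousOn_fderiv_of_isOpen hopen (by norm_num)).mono hsub).clm_apply
      continuousOn_const)
  have hgc : ContinuousOn (fun p : ℝ × E => ‖gradient (f p.1) p.2‖) (Icc a b ×ˢ K) :=
    ((contDiffOn_gradient hT hf).continuousOn.mono
      (hsub.trans (prod_mono_left Ioo_subset_Icc_self))).norm
  rcases (Icc a b ×ˢ K).eq_empty_or_nonempty with hemp | hnon
  · refine ⟨1, one_pos, fun ε _ _ w _ h => ?_⟩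
    have : (a, w a) ∈ Icc a b ×ˢ K := ⟨⟨le_rfl, hab.le⟩, h a ⟨le_rfl, hab.le⟩⟩
    rw [hemp] at this
    exact this
  obtain ⟨p₀, hp₀, hmin⟩ := hIK.exists_isMinOn hnon hgc
  set m := ‖gradient (f p₀.1) p₀.2‖ with hm
  have hm0 : 0 < m := norm_pos_iff.2 (hne _ hp₀.1 _ hp₀.2)
  have hC0 : 0 ≤ C := (norm_nonneg _).trans (hC p₀ hp₀)
  have hC₀0 : 0 ≤ C₀ := (norm_nonneg _).trans (hC₀ p₀ hp₀)
  have hba : 0 < b - a := sub_pos.2 hab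
  set D := C + 2 * C₀ / (b - a) + 1 with hD
  have hD0 : 0 < D := by positivity
  refine ⟨m ^ 2 / D, by positivity, fun ε hε hεε w hw hmem => ?_⟩
  have hp : ∀ s ∈ Icc a b, (s, w s) ∈ Icc a b ×ˢ K := fun s hs => ⟨hs, hmem s hs⟩
  have hDε : D < m ^ 2 / ε := by
    rw [lt_div_iff₀ hε, mul_comm]
    exact (lt_div_iff₀ hD0).1 hεε
  have hcont : ContinuousOn (fun s => f s (w s)) (Icc a b) :=
    hF.continuousOn.comp (f := fun s => (s, w s)) (continuousOn_id.prodMk hw.1)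
      (fun s hs => hsub (hp s hs))
  have key := image_le_of_deriv_right_le_deriv_boundary (a := a) (b := b) hcont
    (fun s hs => hw.hasDerivWithinAt_energy hs (hFd _ (hp s (Ico_subset_Icc_self hs))))
    (B := fun s => f a (w a) + (C - D) * (s - a)) (B' := fun _ => C - D) (by simp)
    (by fun_prop) (fun s _ => by
      simpa using ((((hasDerivAt_id s).sub_const a).const_mul (C - D)).const_add
        (f a (w a))).hasDerivWithinAt) ?_ (x := b) ⟨hab.le, le_rfl⟩
  · have h1 := (abs_le.1 (hC₀ _ (hp b ⟨hab.le, le_rfl⟩))).1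
    have h2 := (abs_le.1 (hC₀ _ (hp a ⟨le_rfl, hab.le⟩))).2
    have h3 : (C - D) * (b - a) = -(2 * C₀) - (b - a) := by
      rw [hD]
      field_simp
      ring
    simp only at key h1 h2
    linarith
  · intro s hs
    have hs' := Ico_subset_Icc_self hs
    have h1 := (abs_le.1 (hC _ (hp s hs'))).2
    have h2 : m ≤ ‖gradient (f s) (w s)‖ := hmin (hp s hs')
    have h3 : m ^ 2 / ε ≤ ‖gradient (f s) (w s)‖ ^ 2 / ε := by gcongr
    linarith

/-- Solutions starting in a fold box leave it through its top before any given later time. -/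
theorem IsFoldBox.exists_exit_time [FiniteDimensional ℝ E] {T : ℝ} (hT : 0 < T) {f : ℝ → E → ℝ}
    (hf : ContDiffOn ℝ 3 (Function.uncurry f) (Icc 0 T ×ˢ univ)) {τ : ℝ} {ξ ℓ : E}
    {A : E →L[ℝ] E} {lam ρ σ δ : ℝ}
    (hbox : IsFoldBox (fun s x => gradient (f s) x) T τ ξ ℓ A lam ρ σ δ) {a b : ℝ}
    (haτ : τ - δ ≤ a) (ha0 : 0 < τ) (ha : a ≤ τ) (hτb : τ < b) (hb : b ≤ τ + δ) (hbT : b < T) :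
    ∃ ε₀ > 0, ∀ ε, 0 < ε → ε < ε₀ → ∀ w, IsSlowFlow (fun s x => gradient (f s) x) ε a b w →
      w a ∈ foldCylinder ξ ℓ ρ σ → ⟪ℓ, w a - ξ⟫ < ρ →
      ∃ s₁ ∈ Ioc a b, ⟪ℓ, w s₁ - ξ⟫ = ρ ∧ ∀ s ∈ Icc a s₁, w s ∈ foldCylinder ξ ℓ ρ σ := by
  obtain ⟨ε₀, hε₀, hesc⟩ := exists_not_forall_mem hT hf (a := (τ + b) / 2) (b := b)
    (by linarith) (by linarith) hbT
    (isCompact_foldCylinder (ξ := ξ) (ℓ := ℓ) hbox.σ_pos hbox.σ_le) (by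
      intro s hs x hx h0
      have := (hbox.eq_zero s (by linarith [hs.1]) (by linarith [hs.2]) (x - ξ) hx.1 hx.2
        (by simpa using h0)).1
      linarith [hs.1])
  refine ⟨ε₀, hε₀, fun ε hε hεε w hw hwa hza => ?_⟩
  have hinv : ∀ b' ≤ b, (∀ s ∈ Icc a b', ⟪ℓ, w s - ξ⟫ ≤ ρ) →
      ∀ s ∈ Icc a b', w s ∈ foldCylinder ξ ℓ ρ σ := fun b' hb' =>
    hbox.mem_foldCylinder (Θ := id) (inv_pos.2 hε) (hw.mono le_rfl hb').1 (hw.mono le_rfl hb').2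
      (fun s hs => abs_le.2 ⟨by simp only [id]; linarith [hs.1],
        by simp only [id]; linarith [hs.2]⟩) hwa
  rcases forall_lt_or_exists_first_hit (q := fun s => ⟪ℓ, w s - ξ⟫) (a := a) (b := b) (c := ρ)
    (continuousOn_const.inner (hw.1.sub continuousOn_const)) hza with h | ⟨s₁, hs₁, heq, hlt⟩
  · refine absurd (fun s hs => ?_) (hesc ε hε hεε w (hw.mono (by linarith) le_rfl))
    exact hinv b le_rfl (fun r hr => (h r hr).le) s ⟨by linarith [hs.1], hs.2⟩
  · refine ⟨s₁, hs₁, heq, hinv s₁ hs₁.2 fun r hr => ?_⟩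
    rcases hr.2.lt_or_eq with h' | h'
    · exact (hlt r ⟨hr.1, h'⟩).le
    · rw [h']; exact heq.le

end Escape

section Jump

variable {E : Type*} [NormedAddCommGroup E] [InnerProductSpace ℝ E]

theorem hasDerivAt_rescale {g : ℝ → E → E} {ε t s : ℝ} (hε : 0 < ε) {w : ℝ → E}
    (hw : HasDerivAt w (-(ε⁻¹ • g (t + ε * s) (w (t + ε * s)))) (t + ε * s)) :
    HasDerivAt (fun s => w (t + ε * s)) (-(g (t + ε * s) (w (t + ε * s)))) s := by
  have h1 : HasDerivAt (fun s => t + ε * s) ε s := by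
    simpa using ((hasDerivAt_id s).const_mul ε).const_add t
  refine (hw.scomp s h1).congr_deriv ?_
  rw [smul_neg, smul_smul, mul_inv_cancel₀ hε.ne', one_smul]

variable [CompleteSpace E] [FiniteDimensional ℝ E] {T : ℝ} {f : ℝ → E → ℝ}

/-- A solution entering a fold box before the critical time follows the heteroclinic orbit. -/
theorem IsFoldBox.exists_follow (hT : 0 < T)
    (hf : ContDiffOn ℝ 3 (Function.uncurry f) (Icc 0 T ×ˢ univ)) {τ : ℝ} (hτ : τ ∈ Ioo 0 T)
    {ξ ℓ : E} {A : E →L[ℝ] E} {lam ρ σ δ : ℝ}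
    (hbox : IsFoldBox (fun s x => gradient (f s) x) T τ ξ ℓ A lam ρ σ δ) {v : ℝ → E} {y : E}
    (hv : ∀ s, HasDerivAt v (-(gradient (f τ) (v s))) s) (hbot : Tendsto v atBot (𝓝 ξ))
    (htop : Tendsto v atTop (𝓝 y)) (hy : gradient (f τ) y = 0) (hyξ : y ≠ ξ) {η : ℝ}
    (hη : 0 < η) :
    ∃ δ₀ > 0, ∀ δ', 0 < δ' → δ' ≤ δ₀ → ∃ ε₀ > 0, ∀ ε, 0 < ε → ε < ε₀ → ∀ w,
      IsSlowFlow (fun s x => gradient (f s) x) ε 0 T w →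
      (∀ s ∈ Ioo 0 T, HasDerivAt w (-(ε⁻¹ • gradient (f s) (w s))) s) →
      (∀ s ∈ Icc (τ - δ') (τ - δ' / 2), w s ∈ foldCylinder ξ ℓ ρ σ ∧ ⟪ℓ, w s - ξ⟫ < ρ) →
      ∃ s₂ ∈ Icc (τ - δ' / 2) (τ + δ'), ‖w s₂ - y‖ ≤ η ∧
        ∀ s ∈ Icc (τ - δ' / 2) s₂, w s ∈ foldCylinder ξ ℓ ρ σ ∨ ∃ r, ‖w s - v r‖ ≤ η := by
  have hg := contDiffOn_gradient hT hf
  have hτ' : τ ∈ Icc 0 T := Ioo_subset_Icc_self hτ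
  obtain ⟨s₁, hs₁, hpast⟩ := hbox.exists_crossing hv hbot htop hy hyξ
  obtain ⟨S', hS'0, hS'⟩ : ∃ S' ≥ 0, ‖v (S' + s₁) - y‖ ≤ η / 2 := by
    have h1 : ∀ᶠ s in atTop, v s ∈ Metric.closedBall y (η / 2) :=
      htop.eventually (Metric.closedBall_mem_nhds y (by positivity))
    obtain ⟨N, hN⟩ := eventually_atTop.1 h1
    refine ⟨max 0 (N - s₁), le_max_left _ _, ?_⟩
    rw [← mem_closedBall_iff_norm]
    exact hN _ (by linarith [le_max_right 0 (N - s₁)])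
  obtain ⟨μ₀, hμ₀, δ₁, hδ₁, hfor⟩ := exists_norm_sub_le_forward
    (g := fun s x => gradient (f s) x) (hg.of_le (by norm_num)) hτ' hv s₁ S' (half_pos hη)
  obtain ⟨S, hS, δ₂, hδ₂, hexit⟩ := hbox.exists_norm_sub_lt_at_exit hg.continuousOn hv hs₁ hpast hμ₀
  refine ⟨min (min δ₁ δ₂) (min δ (min τ (T - τ) / 2)), ?_, fun δ' hδ' hδ'0 => ?_⟩
  · have h1 := hbox.δ_pos
    have h2 : 0 < min τ (T - τ) := lt_min hτ.1 (by linarith [hτ.2])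
    positivity
  obtain ⟨hd1, hd2⟩ := le_min_iff.1 hδ'0
  obtain ⟨hd3, hd4⟩ := le_min_iff.1 hd1
  obtain ⟨hd5, hd6⟩ := le_min_iff.1 hd2
  have hd7 : δ' < τ := by linarith [min_le_left τ (T - τ), hτ.1]
  have hd8 : δ' < T - τ := by linarith [min_le_right τ (T - τ), hτ.2]
  obtain ⟨ε₀, hε₀, hex⟩ := hbox.exists_exit_time hT hf (a := τ - δ' / 2) (b := τ + δ' / 2)
    (by linarith) hτ.1 (by linarith) (by linarith) (by linarith) (by linarith)
  refine ⟨min ε₀ (δ' / 2 / (S + S' + 1)), by positivity, fun ε hε hεε w hw hwd hwin => ?_⟩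
  have hεS : ε * (S + S' + 1) < δ' / 2 :=
    (lt_div_iff₀ (by positivity)).1 (hεε.trans_le (min_le_right _ _))
  have hεS1 : 0 ≤ ε * S := by positivity
  have hεS2 : 0 ≤ ε * S' := by positivity
  have hstart := hwin (τ - δ' / 2) ⟨by linarith, le_rfl⟩
  obtain ⟨t, ht, htz, htc⟩ := hex ε hε (hεε.trans_le (min_le_left _ _)) w
    (hw.mono (by linarith) (by linarith)) hstart.1 hstart.2
  have hW : ∀ s ∈ Icc (-S) S', HasDerivAt (fun s => w (t + ε * s))
      (-(gradient (f (t + ε * s)) (w (t + ε * s)))) s ∧ |t + ε * s - τ| ≤ δ' := by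
    intro s hs
    have h1 : ε * -S ≤ ε * s := by gcongr; exact hs.1
    have h2 : ε * s ≤ ε * S' := by gcongr; exact hs.2
    refine ⟨hasDerivAt_rescale (g := fun s x => gradient (f s) x) hε
      (hwd _ ⟨by linarith [ht.1], by linarith [ht.2]⟩),
      abs_le.2 ⟨by linarith [ht.1], by linarith [ht.2]⟩⟩
  have hclose := hexit (fun s => w (t + ε * s)) (fun s => t + ε * s)
    (fun s hs => (hW s ⟨hs.1, hs.2.trans hS'0⟩).1)
    (fun s hs => (hW s ⟨hs.1, hs.2.trans hS'0⟩).2.trans hd4)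
    (fun s hs => by
      have h1 : ε * -S ≤ ε * s := by gcongr; exact hs.1
      have h2 : ε * s ≤ 0 := mul_nonpos_of_nonneg_of_nonpos hε.le hs.2
      rcases le_total (τ - δ' / 2) (t + ε * s) with h | h
      · exact htc _ ⟨h, by linarith⟩
      · exact (hwin _ ⟨by linarith [ht.1], h⟩).1)
    (by simpa using htz)
  have hforw := hfor (fun s => w (t + ε * s)) (fun s => t + ε * s)
    (fun s hs => (hW s ⟨by linarith [hs.1], hs.2⟩).1)
    (fun s hs => by
      have h1 := (hW s ⟨by linarith [hs.1], hs.2⟩).2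
      have h2 := abs_le.1 h1
      exact ⟨⟨by linarith, by linarith⟩, h1.trans hd3⟩) hclose.le
  refine ⟨t + ε * S', ⟨by linarith [ht.1], by linarith [ht.2]⟩, ?_, fun s hs => ?_⟩
  · have h1 := hforw S' ⟨hS'0, le_rfl⟩
    have h2 := norm_sub_le_norm_sub_add_norm_sub (w (t + ε * S')) (v (S' + s₁)) y
    linarith
  · rcases le_total s t with h | h
    · exact Or.inl (htc s ⟨hs.1, h⟩)
    · right
      have h3 : t + ε * ((s - t) / ε) = s := by field_simp; ring
      have h1 := hforw ((s - t) / ε) ⟨div_nonneg (by linarith) hε.le, by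
        rw [div_le_iff₀ hε]; linarith [hs.2]⟩
      simp only [h3] at h1
      exact ⟨_, h1.trans (by linarith)⟩

/-- On `[0, b]` the family `w` approaches `G`, and on `(a₀, c)` it converges to `U`, locally
uniformly. -/
def ApproximatesOn (G : Set (ℝ × E)) (w : ℝ → ℝ → E) (a₀ c : ℝ) (U : ℝ → E) : Prop :=
  ∀ a b, a₀ < a → a ≤ b → b < c → ∀ η > 0, ∀ᶠ ε in 𝓝[>] (0 : ℝ),
    (∀ s ∈ Icc 0 b, Metric.infDist (s, w ε s) G < η) ∧ ∀ s ∈ Icc a b, ‖w ε s - U s‖ ≤ η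

theorem infDist_lt_of_mem {F : Type*} [SeminormedAddCommGroup F] {G : Set (ℝ × F)} {s s' η : ℝ}
    {x x' : F} (h : (s', x') ∈ G)
    (hs : |s - s'| < η) (hx : ‖x - x'‖ < η) : Metric.infDist (s, x) G < η := by
  refine (Metric.infDist_le_dist_of_mem h).trans_lt ?_
  rw [Prod.dist_eq, max_lt_iff, Real.dist_eq, dist_eq_norm]
  exact ⟨hs, hx⟩

theorem ApproximatesOn.jump (hT : 0 < T)
    (hf : ContDiffOn ℝ 3 (Function.uncurry f) (Icc 0 T ×ˢ univ)) {τ : ℝ} (hτ : τ ∈ Ioo 0 T)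
    {ξ : E} (hbox : ∃ ℓ A lam, ∀ r₀ > 0, ∃ ρ σ δ, 2 * ρ ≤ r₀ ∧ δ ≤ r₀ ∧
      IsFoldBox (fun s x => gradient (f s) x) T τ ξ ℓ A lam ρ σ δ) {v : ℝ → E} {y : E}
    (hv : ∀ s, HasDerivAt v (-(gradient (f τ) (v s))) s) (hbot : Tendsto v atBot (𝓝 ξ))
    (htop : Tendsto v atTop (𝓝 y)) (hyξ : y ≠ ξ)
    {a₀ c : ℝ} {U V : ℝ → E} (ha₀ : a₀ < τ) (hU : Tendsto U (𝓝[<] τ) (𝓝 ξ)) (hτc : τ < c)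
    (hcT : c ≤ T) (hV : ContDiffOn ℝ 1 V (Ico τ c)) (hVτ : V τ = y)
    (hVcrit : ∀ s ∈ Ico τ c, gradient (f s) (V s) = 0)
    (hVpd : ∀ s ∈ Ico τ c, ∀ z ≠ 0, 0 < ⟪fderiv ℝ (gradient (f s)) (V s) z, z⟫)
    {w : ℝ → ℝ → E} (hw : ∀ ε > 0, IsSlowFlow (fun s x => gradient (f s) x) ε 0 T (w ε))
    (hwd : ∀ ε > 0, ∀ s ∈ Ioo 0 T, HasDerivAt (w ε) (-(ε⁻¹ • gradient (f s) (w ε s))) s)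
    {G : Set (ℝ × E)} (hGξ : (τ, ξ) ∈ G) (hGv : ∀ r, (τ, v r) ∈ G)
    (hGV : ∀ s ∈ Ico τ c, (s, V s) ∈ G) (hprev : ApproximatesOn G w a₀ τ U) :
    ApproximatesOn G w τ c V := by
  intro a b ha hab hb η hη
  have hg := contDiffOn_gradient hT hf
  have hg1 := hg.of_le (show (1 : WithTop ℕ∞) ≤ 2 by norm_num)
  have hτ' : τ ∈ Icc 0 T := Ioo_subset_Icc_self hτ
  have hτc' : τ ∈ Ico τ c := ⟨le_rfl, hτc⟩
  have hy : gradient (f τ) y = 0 := hVτ ▸ hVcrit τ hτc'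
  obtain ⟨Rt, hRt, htrack⟩ := exists_tracking hT hg1 hτ'.1 hb (hb.le.trans hcT) hV hVcrit hVpd
  obtain ⟨Rb, hRb, hball⟩ := exists_ball_invariant hT hg1 hτ' hy
    (hVτ ▸ hVpd τ hτc')
  set η₃ := min (η / 2) Rt with hη₃
  have hη₃0 : 0 < η₃ := by positivity
  set η₂ := min (η₃ / 2) Rb with hη₂
  have hη₂0 : 0 < η₂ := by positivity
  have hη₃η : η₃ ≤ η / 2 := min_le_left _ _
  have hη₂η : η₂ ≤ η₃ / 2 := min_le_left _ _
  obtain ⟨ε₁, hε₁, htrack⟩ := htrack η₃ hη₃0 (min_le_right _ _)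
  obtain ⟨δb, hδb, hball⟩ := hball η₂ hη₂0 (min_le_right _ _)
  obtain ⟨ℓ, A, lam, hbox⟩ := hbox
  obtain ⟨ρ, σ, δ, hρη, -, hbox⟩ := hbox (η / 2) (by positivity)
  obtain ⟨δ₀, hδ₀, hfollow⟩ := hbox.exists_follow hT hf hτ hv hbot htop hy hyξ hη₂0
  obtain ⟨r, hr, hrc⟩ := Metric.mem_nhds_iff.1
    (foldCylinder_mem_nhds (ξ := ξ) (ℓ := ℓ) hbox.σ_pos hbox.ρ_pos)
  obtain ⟨l, hl, hlU⟩ := (mem_nhdsLT_iff_exists_Ioo_subset).1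
    (hU.eventually (Metric.ball_mem_nhds ξ (half_pos hr)))
  obtain ⟨δV, hδV, hVc⟩ := Metric.continuousWithinAt_iff.1 (hV.continuousOn τ hτc') η₂ hη₂0
  rw [mem_Iio] at hl
  obtain ⟨δ', hδ', h1, h2, h3, h4, h5, h6, h7, h8⟩ : ∃ δ' > 0, δ' ≤ δ₀ ∧ δ' ≤ δb ∧ δ' < τ - l ∧
      δ' < δV ∧ δ' ≤ η / 2 ∧ δ' ≤ a - τ ∧ δ' < τ - a₀ ∧ δ' < τ := by
    have hev : ∀ᶠ δ' in 𝓝[>] (0 : ℝ), δ' ≤ δ₀ ∧ δ' ≤ δb ∧ δ' < τ - l ∧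
        δ' < δV ∧ δ' ≤ η / 2 ∧ δ' ≤ a - τ ∧ δ' < τ - a₀ ∧ δ' < τ := by
      have hle : ∀ p > (0 : ℝ), ∀ᶠ δ' in 𝓝[>] (0 : ℝ), δ' < p := fun p hp =>
        nhdsWithin_le_nhds (gt_mem_nhds hp)
      filter_upwards [hle δ₀ hδ₀, hle δb hδb, hle (τ - l) (by linarith), hle δV hδV,
        hle (η / 2) (by positivity), hle (a - τ) (by linarith), hle (τ - a₀) (by linarith),
        hle τ hτ.1] with d e1 e2 e3 e4 e5 e6 e7 e8
      exact ⟨e1.le, e2.le, e3, e4, e5.le, e6.le, e7, e8⟩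
    obtain ⟨d, hd, hd0⟩ := (hev.and self_mem_nhdsWithin).exists
    exact ⟨d, hd0, hd⟩
  obtain ⟨ε₂, hε₂, hfollow⟩ := hfollow δ' hδ' h1
  have hVδ : ‖V (τ + δ') - y‖ ≤ η₂ := by
    have := hVc (x := τ + δ') ⟨by linarith, by linarith⟩ (by
      rw [Real.dist_eq, add_sub_cancel_left, abs_of_pos hδ']; exact h4)
    rw [dist_eq_norm, hVτ] at this
    exact this.le
  filter_upwards [hprev (τ - δ') (τ - δ' / 2) (by linarith) (by linarith) (by linarith)
    (min η (r / 4)) (by positivity), self_mem_nhdsWithin,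
    nhdsWithin_le_nhds (gt_mem_nhds hε₁), nhdsWithin_le_nhds (gt_mem_nhds hε₂)]
    with ε ⟨hQ1, hQ2⟩ hε hεε₁ hεε₂
  have hwin : ∀ s ∈ Icc (τ - δ') (τ - δ' / 2),
      w ε s ∈ foldCylinder ξ ℓ ρ σ ∧ ⟪ℓ, w ε s - ξ⟫ < ρ := by
    intro s hs
    have e1 : U s ∈ Metric.ball ξ (r / 2) := hlU ⟨by linarith [hs.1], by linarith [hs.2]⟩
    rw [mem_ball_iff_norm] at e1
    have e2 := (hQ2 s hs).trans (min_le_right _ _)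
    have e3 := norm_sub_le_norm_sub_add_norm_sub (w ε s) (U s) ξ
    exact hrc (by rw [mem_ball_iff_norm]; linarith)
  obtain ⟨s₂, hs₂, hs₂y, hs₂f⟩ := hfollow ε hε hεε₂ (w ε) (hw ε hε) (hwd ε hε) hwin
  have hcT' : τ + δ' ≤ T := by linarith
  have hs₂0 : 0 ≤ s₂ := by linarith [hs₂.1]
  have hland := hball ε hε s₂ (τ + δ') hs₂0 hcT' (by linarith [hs₂.1]) (by linarith) (w ε)
    ((hw ε hε).mono hs₂0 hcT') hs₂y
  have htr := htrack ε hε hεε₁ (w ε) (τ + δ') b (by linarith) le_rfl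
    ((hw ε hε).mono (by linarith [hτ.1]) (by linarith)) (by
      have e1 := hland (τ + δ') ⟨hs₂.2, le_rfl⟩
      have e2 := norm_sub_le_norm_sub_add_norm_sub (w ε (τ + δ')) y (V (τ + δ'))
      rw [norm_sub_rev y] at e2
      linarith)
  refine ⟨fun s hs => ?_, fun s hs => (htr s ⟨by linarith [hs.1], hs.2⟩).trans (by linarith)⟩
  rcases le_total s (τ - δ' / 2) with hs1 | hs1
  · exact (hQ1 s ⟨hs.1, hs1⟩).trans_le (min_le_left _ _)
  rcases le_total s s₂ with hs3 | hs3
  · have hsτ : |s - τ| < η := abs_lt.2 ⟨by linarith, by linarith [hs₂.2]⟩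
    rcases hs₂f s ⟨hs1, hs3⟩ with h | ⟨q, hq⟩
    · refine infDist_lt_of_mem hGξ hsτ ?_
      have := norm_le_of_mem_cylinder hbox.σ_pos hbox.σ_le h.1 h.2
      linarith
    · exact infDist_lt_of_mem (hGv q) hsτ (by linarith)
  rcases le_total s (τ + δ') with hs4 | hs4
  · refine infDist_lt_of_mem (hVτ ▸ hGV τ hτc') (abs_lt.2 ⟨by linarith, by linarith⟩) ?_
    linarith [hland s ⟨hs3, hs4⟩]
  · refine infDist_lt_of_mem (hGV s ⟨by linarith, by linarith [hs.2]⟩) (by simpa using hη) ?_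
    linarith [htr s ⟨hs4, hs.2⟩]

end Jump

section Assembly

variable {E : Type*} [NormedAddCommGroup E] [InnerProductSpace ℝ E] [CompleteSpace E]
  {T : ℝ} {f : ℝ → E → ℝ}

theorem gradient_eq_zero_of_tendsto (hT : 0 < T)
    (hf : ContDiffOn ℝ 3 (Function.uncurry f) (Icc 0 T ×ˢ univ)) {U : ℝ → E} {ξ : E}
    (hU : Tendsto U (𝓝[<] T) (𝓝 ξ)) (hcrit : ∀ᶠ s in 𝓝[<] T, gradient (f s) (U s) = 0)
    (hpd : ∀ᶠ s in 𝓝[<] T, ∀ z ≠ 0, 0 < ⟪fderiv ℝ (gradient (f s)) (U s) z, z⟫) :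
    gradient (f T) ξ = 0 ∧ ∀ z, 0 ≤ ⟪fderiv ℝ (gradient (f T)) ξ z, z⟫ := by
  have hg1 := (contDiffOn_gradient hT hf).of_le (show (1 : WithTop ℕ∞) ≤ 2 by norm_num)
  have hmem : (T, ξ) ∈ Icc 0 T ×ˢ (univ : Set E) := ⟨⟨hT.le, le_rfl⟩, mem_univ _⟩
  have hlim : Tendsto (fun s => (s, U s)) (𝓝[<] T) (𝓝[Icc 0 T ×ˢ univ] (T, ξ)) := by
    refine tendsto_nhdsWithin_iff.2
      ⟨(tendsto_id.mono_left nhdsWithin_le_nhds).prodMk_nhds hU, ?_⟩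
    filter_upwards [Ioo_mem_nhdsLT hT] with s hs using ⟨⟨hs.1.le, hs.2.le⟩, mem_univ _⟩
  refine ⟨tendsto_nhds_unique ((hg1.continuousOn _ hmem).tendsto.comp hlim)
    (tendsto_const_nhds.congr' (hcrit.mono fun s hs => hs.symm)), fun z => ?_⟩
  have h1 : Tendsto (fun s => fderiv ℝ (gradient (f s)) (U s)) (𝓝[<] T)
      (𝓝 (fderiv ℝ (gradient (f T)) ξ)) :=
    (continuousOn_fderiv_slice hT hg1 _ hmem).tendsto.comp hlim
  have h2 : Tendsto (fun s => ⟪fderiv ℝ (gradient (f s)) (U s) z, z⟫) (𝓝[<] T)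
      (𝓝 ⟪fderiv ℝ (gradient (f T)) ξ z, z⟫) :=
    (((ContinuousLinearMap.apply ℝ E z).continuous.tendsto _).comp h1).inner tendsto_const_nhds
  refine ge_of_tendsto h2 (hpd.mono fun s hs => ?_)
  rcases eq_or_ne z 0 with rfl | hz
  · simp
  · exact (hs z hz).le

variable [FiniteDimensional ℝ E] {w : ℝ → ℝ → E} {G : Set (ℝ × E)}

theorem approximatesOn_start (hT : 0 < T)
    (hf : ContDiffOn ℝ 3 (Function.uncurry f) (Icc 0 T ×ˢ univ)) {c : ℝ} (hcT : c ≤ T)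
    {V : ℝ → E} (hV : ContDiffOn ℝ 1 V (Ico 0 c))
    (hVcrit : ∀ s ∈ Ico 0 c, gradient (f s) (V s) = 0)
    (hVpd : ∀ s ∈ Ico 0 c, ∀ z ≠ 0, 0 < ⟪fderiv ℝ (gradient (f s)) (V s) z, z⟫)
    (hw : ∀ ε > 0, IsSlowFlow (fun s x => gradient (f s) x) ε 0 T (w ε))
    (hinit : Tendsto (fun ε => w ε 0) (𝓝[>] 0) (𝓝 (V 0)))
    (hGV : ∀ s ∈ Ico 0 c, (s, V s) ∈ G) : ApproximatesOn G w 0 c V := by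
  intro a b ha hab hb η hη
  have hg1 := (contDiffOn_gradient hT hf).of_le (show (1 : WithTop ℕ∞) ≤ 2 by norm_num)
  obtain ⟨R, hR, htrack⟩ := exists_tracking hT hg1 le_rfl hb (hb.le.trans hcT) hV hVcrit hVpd
  obtain ⟨ε₀, hε₀, htrack⟩ := htrack (min (η / 2) R) (by positivity) (min_le_right _ _)
  filter_upwards [hinit.eventually (Metric.closedBall_mem_nhds (V 0)
    (show 0 < min (η / 2) R by positivity)), self_mem_nhdsWithin,
    nhdsWithin_le_nhds (gt_mem_nhds hε₀)] with ε h0 hε hεε₀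
  have hmin : min (η / 2) R ≤ η / 2 := min_le_left _ _
  have htr := htrack ε hε hεε₀ (w ε) 0 b le_rfl le_rfl ((hw ε hε).mono le_rfl (hb.le.trans hcT))
    (mem_closedBall_iff_norm.1 h0)
  refine ⟨fun s hs => ?_, fun s hs => (htr s ⟨by linarith [hs.1], hs.2⟩).trans (by linarith)⟩
  refine infDist_lt_of_mem (hGV s ⟨hs.1, by linarith [hs.2]⟩) (by simpa using hη) ?_
  linarith [htr s hs]

theorem ApproximatesOn.eventually_infDist_lt (hT : 0 < T)
    (hf : ContDiffOn ℝ 3 (Function.uncurry f) (Icc 0 T ×ˢ univ)) {a₀ : ℝ} (ha₀ : a₀ < T)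
    {U : ℝ → E} {ξ : E} (hU : Tendsto U (𝓝[<] T) (𝓝 ξ)) (hξ : gradient (f T) ξ = 0)
    (hpd : ∀ z ≠ 0, 0 < ⟪fderiv ℝ (gradient (f T)) ξ z, z⟫)
    (hw : ∀ ε > 0, IsSlowFlow (fun s x => gradient (f s) x) ε 0 T (w ε))
    (hGξ : (T, ξ) ∈ G) (hprev : ApproximatesOn G w a₀ T U) {η : ℝ} (hη : 0 < η) :
    ∀ᶠ ε in 𝓝[>] (0 : ℝ), ∀ s ∈ Icc 0 T, Metric.infDist (s, w ε s) G < η := by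
  have hg1 := (contDiffOn_gradient hT hf).of_le (show (1 : WithTop ℕ∞) ≤ 2 by norm_num)
  obtain ⟨R, hR, hball⟩ := exists_ball_invariant hT hg1 ⟨hT.le, le_rfl⟩ hξ hpd
  set η' := min (η / 2) R with hη'
  have hη'0 : 0 < η' := by positivity
  have hη'η : η' ≤ η / 2 := min_le_left _ _
  obtain ⟨δ, hδ, hball⟩ := hball η' hη'0 (min_le_right _ _)
  obtain ⟨a, hUa, ha0, haδ, haη, haa, haT⟩ : ∃ a, ‖U a - ξ‖ < η' / 2 ∧ 0 < a ∧ T - δ < a ∧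
      T - η < a ∧ a₀ < a ∧ a < T := by
    have hlt : ∀ p < T, ∀ᶠ a in 𝓝[<] T, p < a := fun p hp => nhdsWithin_le_nhds (lt_mem_nhds hp)
    refine ((hU.eventually (Metric.ball_mem_nhds ξ (half_pos hη'0))).and ((hlt 0 hT).and
      ((hlt (T - δ) (by linarith)).and ((hlt (T - η) (by linarith)).and
      ((hlt a₀ ha₀).and self_mem_nhdsWithin))))).exists.imp fun a h => ?_
    rwa [dist_eq_norm] at h
  filter_upwards [hprev a a haa le_rfl haT (min η (η' / 2)) (by positivity), self_mem_nhdsWithin]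
    with ε ⟨h1, h2⟩ hε s hs
  rcases le_total s a with hsa | hsa
  · exact (h1 s ⟨hs.1, hsa⟩).trans_le (min_le_left _ _)
  have h3 := (h2 a ⟨le_rfl, le_rfl⟩).trans (min_le_right _ _)
  have h4 := norm_sub_le_norm_sub_add_norm_sub (w ε a) (U a) ξ
  have h5 := hball ε hε a T ha0.le le_rfl haδ.le (by linarith) (w ε)
    ((hw ε hε).mono ha0.le le_rfl) (by linarith) s ⟨hsa, hs.2⟩
  exact infDist_lt_of_mem hGξ (abs_lt.2 ⟨by linarith, by linarith [hs.2]⟩) (by linarith)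

end Assembly

theorem inner_pos_of_det_ne_zero {E : Type*} [NormedAddCommGroup E] [InnerProductSpace ℝ E]
    [FiniteDimensional ℝ E] {A : E →L[ℝ] E} (hsymm : ∀ v w, ⟪A v, w⟫ = ⟪v, A w⟫)
    (hpos : ∀ v, 0 ≤ ⟪A v, v⟫) (hdet : LinearMap.det (A : E →ₗ[ℝ] E) ≠ 0) {v : E} (hv : v ≠ 0) :
    0 < ⟪A v, v⟫ := by
  refine (hpos v).lt_of_ne fun h => hv ?_
  have h1 := apply_eq_zero_of_inner_eq_zero hsymm hpos h.symm
  have h2 := (LinearMap.isUnit_iff_ker_eq_bot _).1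
    ((LinearMap.isUnit_iff_isUnit_det (A : E →ₗ[ℝ] E)).2 hdet.isUnit)
  exact LinearMap.ker_eq_bot'.1 h2 v h1

/-- Theorem `tm:main`, part 3: the graph of `u_ε` approaches, uniformly
in `t ∈ [0,T]`, the completion `G` of the graph of `u` obtained by adding the closed
heteroclinic trajectories `γ_i = v_i(ℝ) ∪ {x_i, y_i}` at the critical times `t_i`. -/
theorem main_theorem_graph_convergence
    {n : ℕ} (hn : 1 ≤ n) {T : ℝ} (hT : 0 < T)
    (f : ℝ → EuclideanSpace ℝ (Fin n) → ℝ)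
    (hf : ContDiffOn ℝ 3 (Function.uncurry f)
      (Set.Icc 0 T ×ˢ (Set.univ : Set (EuclideanSpace ℝ (Fin n)))))
    {a₀ c₀ : ℝ} (ha₀ : 0 ≤ a₀) (hc₀ : 0 < c₀)
    (hA1 : ∀ t ∈ Set.Icc (0:ℝ) T, ∀ x : EuclideanSpace ℝ (Fin n),
      ⟪gradient (f t) x, x⟫ ≥ c₀ * ‖x‖ ^ 2 - a₀)
    (hA2 : ∀ p ∈ degenerateCriticalSet T f, HessPosSemidef f p.1 p.2 →
      ∃ ℓ : EuclideanSpace ℝ (Fin n), ℓ ≠ 0 ∧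
        LinearMap.ker (fderiv ℝ (gradient (f p.1)) p.2).toLinearMap = Submodule.span ℝ {ℓ} ∧
        ⟪gradft f p.1 p.2, ℓ⟫ ≠ 0 ∧ thirdDeriv f p.1 p.2 ℓ ≠ 0)
    (hA3fin : (degenerateCriticalSet T f).Finite)
    (hA3inj : ∀ p ∈ degenerateCriticalSet T f, ∀ q ∈ degenerateCriticalSet T f,
      p.1 = q.1 → p = q)
    (hA3end : ∀ p ∈ degenerateCriticalSet T f, p.1 ≠ 0 ∧ p.1 ≠ T)
    (hA4 : ∀ p ∈ degenerateCriticalSet T f, HessPosSemidef f p.1 p.2 →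
      ∀ w : ℝ → EuclideanSpace ℝ (Fin n),
        (∀ s : ℝ, HasDerivAt w (-(gradient (f p.1) (w s))) s) →
        Tendsto w atBot (nhds p.2) → (∃ s₁ s₂ : ℝ, w s₁ ≠ w s₂) →
        ∃ wlim : EuclideanSpace ℝ (Fin n),
          Tendsto w atTop (nhds wlim) ∧ HessPosDef f p.1 wlim)
    (y₀ : EuclideanSpace ℝ (Fin n))
    (hy₀ : gradient (f 0) y₀ = 0) (hy₀pd : HessPosDef f 0 y₀)
    (k : ℕ) (hk : 1 ≤ k) (t : ℕ → ℝ)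
    (ht0 : t 0 = 0) (htk : t k = T) (htmono : ∀ i < k, t i < t (i + 1))
    (ui vi : ℕ → ℝ → EuclideanSpace ℝ (Fin n))
    (x y : ℕ → EuclideanSpace ℝ (Fin n))
    (hu1 : ui 1 0 = y₀)
    (huiC2 : ∀ i, 1 ≤ i → i ≤ k → ContDiffOn ℝ 2 (ui i) (Set.Ico (t (i - 1)) (t i)))
    (huicrit : ∀ i, 1 ≤ i → i ≤ k → ∀ s ∈ Set.Ico (t (i - 1)) (t i),
      gradient (f s) (ui i s) = 0 ∧ HessPosDef f s (ui i s))
    (hx : ∀ i, 1 ≤ i → i ≤ k →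
      Tendsto (ui i) (nhdsWithin (t i) (Set.Iio (t i))) (nhds (x i)))
    (hxdeg : ∀ i, 1 ≤ i → i ≤ k - 1 →
      (t i, x i) ∈ degenerateCriticalSet T f ∧ HessPosSemidef f (t i) (x i))
    (hy : ∀ i, 1 ≤ i → i ≤ k - 1 → y i = ui (i + 1) (t i))
    (hviC2 : ∀ i, 1 ≤ i → i ≤ k - 1 → ContDiff ℝ 2 (vi i))
    (hvinc : ∀ i, 1 ≤ i → i ≤ k - 1 → ∃ s₁ s₂ : ℝ, vi i s₁ ≠ vi i s₂)
    (hvode : ∀ i, 1 ≤ i → i ≤ k - 1 →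
      ∀ s : ℝ, HasDerivAt (vi i) (-(gradient (f (t i)) (vi i s))) s)
    (hvlim : ∀ i, 1 ≤ i → i ≤ k - 1 →
      Tendsto (vi i) atBot (nhds (x i)) ∧ Tendsto (vi i) atTop (nhds (y i)))
    (u : ℝ → EuclideanSpace ℝ (Fin n))
    (hupiece : ∀ i, 1 ≤ i → i ≤ k → ∀ s ∈ Set.Ico (t (i - 1)) (t i), u s = ui i s)
    (huT : u T = x k)
    (uε : ℝ → ℝ → EuclideanSpace ℝ (Fin n)) (yε : ℝ → EuclideanSpace ℝ (Fin n))
    (hode : ∀ ε : ℝ, 0 < ε → ∀ s ∈ Set.Icc (0:ℝ) T,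
      HasDerivWithinAt (uε ε) (-(ε⁻¹ • gradient (f s) (uε ε s))) (Set.Icc 0 T) s)
    (hinit : ∀ ε : ℝ, 0 < ε → uε ε 0 = yε ε)
    (hyε : Tendsto yε (nhdsWithin 0 (Set.Ioi 0)) (nhds y₀)) :
    ∀ η > (0:ℝ), ∀ᶠ ε : ℝ in nhdsWithin 0 (Set.Ioi 0), ∀ s ∈ Set.Icc (0:ℝ) T,
      Metric.infDist ((s, uε ε s) : ℝ × EuclideanSpace ℝ (Fin n))
        ((fun r : ℝ => ((r, u r) : ℝ × EuclideanSpace ℝ (Fin n))) '' Set.Icc 0 T ∪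
          ⋃ i ∈ {j : ℕ | 1 ≤ j ∧ j ≤ k - 1},
            {t i} ×ˢ (Set.range (vi i) ∪ {x i, y i})) < η := by
  set G : Set (ℝ × EuclideanSpace ℝ (Fin n)) :=
    (fun r : ℝ => ((r, u r) : ℝ × EuclideanSpace ℝ (Fin n))) '' Set.Icc 0 T ∪
      ⋃ i ∈ {j : ℕ | 1 ≤ j ∧ j ≤ k - 1}, {t i} ×ˢ (Set.range (vi i) ∪ {x i, y i}) with hG
  have hmono : StrictMonoOn t (Iic k) :=
    strictMonoOn_Iic_of_lt_succ fun i hi => htmono i hi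
  have hnonneg : ∀ i ≤ k, 0 ≤ t i := fun i hi =>
    ht0 ▸ hmono.monotoneOn (mem_Iic.2 k.zero_le) hi i.zero_le
  have hleT : ∀ i ≤ k, t i ≤ T := fun i hi => htk ▸ hmono.monotoneOn hi (mem_Iic.2 le_rfl) hi
  have hw : ∀ ε > 0, IsSlowFlow (fun s x => gradient (f s) x) ε 0 T (uε ε) := fun ε hε =>
    isSlowFlow_of_hasDerivWithinAt (hode ε hε)
  have hwd : ∀ ε > 0, ∀ s ∈ Ioo 0 T,
      HasDerivAt (uε ε) (-(ε⁻¹ • gradient (f s) (uε ε s))) s := fun ε hε s hs =>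
    (hode ε hε s (Ioo_subset_Icc_self hs)).hasDerivAt (Icc_mem_nhds hs.1 hs.2)
  have hGu : ∀ i, 1 ≤ i → i ≤ k → ∀ s ∈ Ico (t (i - 1)) (t i), (s, ui i s) ∈ G := by
    intro i hi hik s hs
    refine Or.inl ⟨s, ⟨(hnonneg _ (by lia)).trans hs.1, hs.2.le.trans (hleT i hik)⟩, ?_⟩
    rw [← hupiece i hi hik s hs]
  have hGv : ∀ i, 1 ≤ i → i ≤ k - 1 → ∀ z ∈ Set.range (vi i) ∪ {x i, y i}, (t i, z) ∈ G :=
    fun i hi hik z hz => Or.inr (mem_iUnion₂.2 ⟨i, ⟨hi, hik⟩, rfl, hz⟩)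
  have hC1 : ∀ i, 1 ≤ i → i ≤ k → ContDiffOn ℝ 1 (ui i) (Ico (t (i - 1)) (t i)) :=
    fun i hi hik => (huiC2 i hi hik).of_le (by norm_num)
  have hlast : ∀ i, 1 ≤ i → i ≤ k → ∀ᶠ s in 𝓝[<] t i, s ∈ Ico (t (i - 1)) (t i) := by
    intro i hi hik
    obtain ⟨j, rfl⟩ := Nat.exists_eq_add_of_le' hi
    exact Ico_mem_nhdsLT (htmono j (by lia))
  have happ : ∀ i, 1 ≤ i → i ≤ k → ApproximatesOn G uε (t (i - 1)) (t i) (ui i) := by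
    intro i hi
    induction i, hi using Nat.le_induction with
    | base =>
      intro hik
      have hc := huicrit 1 le_rfl hik
      have hC := hC1 1 le_rfl hik
      have hGc := hGu 1 le_rfl hik
      simp only [Nat.sub_self, ht0] at hc hC hGc ⊢
      refine approximatesOn_start hT hf (hleT 1 hik) hC (fun s hs => (hc s hs).1)
        (fun s hs => (hc s hs).2) hw ?_ hGc
      rw [hu1]
      exact hyε.congr' (eventually_mem_nhdsWithin.mono fun ε hε => (hinit ε hε).symm)
    | succ i hi ih =>
      intro hik
      have hik' : i ≤ k - 1 := by lia
      obtain ⟨hdeg, hpsd⟩ := hxdeg i hi hik'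
      obtain ⟨ℓ, hℓ, hker, hft, hthird⟩ := hA2 _ hdeg hpsd
      have hc := huicrit (i + 1) (by lia) hik
      have hC := hC1 (i + 1) (by lia) hik
      have hGc := hGu (i + 1) (by lia) hik
      simp only [Nat.add_sub_cancel] at hc hC hGc ⊢
      have hτ : t i ∈ Ioo 0 T := by
        obtain ⟨h1, h2⟩ := hA3end _ hdeg
        exact ⟨(hnonneg i (by lia)).lt_of_ne h1.symm, (hleT i (by lia)).lt_of_ne h2⟩
      have hlt : t i < t (i + 1) := htmono i (by lia)
      have hyi := hy i hi hik'
      have hyξ : y i ≠ x i := by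
        intro h
        have h1 := (hc (t i) ⟨le_rfl, hlt⟩).2 ℓ hℓ
        rw [← hyi, h] at h1
        have h2 : fderiv ℝ (gradient (f (t i))) (x i) ℓ = 0 := by
          have : ℓ ∈ LinearMap.ker (fderiv ℝ (gradient (f (t i))) (x i)).toLinearMap :=
            hker ▸ Submodule.mem_span_singleton_self ℓ
          simpa using this
        simp [h2] at h1
      have hpast : t (i - 1) < t i := by
        obtain ⟨j, rfl⟩ := Nat.exists_eq_add_of_le' hi
        exact htmono j (by lia)
      have hbox := exists_isFoldBox_of_transversal hT hf hτ hdeg.2.1 hpsd hℓ hker hft hthird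
        (hx i hi (by lia)) ((hlast i hi (by lia)).mono fun s hs => (huicrit i hi (by lia) s hs).1)
      exact ApproximatesOn.jump hT hf hτ hbox (hvode i hi hik') (hvlim i hi hik').1
        (hvlim i hi hik').2 hyξ hpast (hx i hi (by lia)) hlt (hleT _ hik) hC hyi.symm
        (fun s hs => (hc s hs).1) (fun s hs => (hc s hs).2) hw hwd
        (hGv i hi hik' _ (by simp)) (fun r => hGv i hi hik' _ (by simp)) hGc (ih (by lia))
  intro η hη
  have hxk := hx k hk le_rfl
  have hlk := hlast k hk le_rfl
  have hak := happ k hk le_rfl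
  have hlt : t (k - 1) < t k := hmono (by simp) (by simp) (by lia)
  rw [htk] at hxk hlk hak hlt
  have hcrit := huicrit k hk le_rfl
  rw [htk] at hcrit
  obtain ⟨h1, h2⟩ := gradient_eq_zero_of_tendsto hT hf hxk (hlk.mono fun s hs => (hcrit s hs).1)
    (hlk.mono fun s hs => (hcrit s hs).2)
  have hTmem : T ∈ Icc 0 T := ⟨hT.le, le_rfl⟩
  refine hak.eventually_infDist_lt hT hf hlt hxk h1 (fun z hz => ?_) hw
    (Or.inl ⟨T, hTmem, congrArg (Prod.mk T) huT⟩) hη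
  refine inner_pos_of_det_ne_zero (inner_fderiv_gradient_comm
    ((contDiff_slice hf hTmem).of_le (by norm_num)) _) h2 (fun hdet => ?_) hz
  exact (hA3end (T, x k) ⟨hTmem, h1, hdet⟩).2 rfl
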